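/- arXiv:1505.02703 — 8 statements merged into one kernel-verified Lean document; each statement's English description precedes it below -/
import Mathlib

section
/- Let n ≥ 1, Q > 0, and V ∈ M_n(ℂ) be such that Q·V·conj(V) is unitary. Let μ_1 ≥ μ_2 ≥ … ≥ μ_n be the eigenvalues, arranged in decreasing order, of the positive semidefinite Hermitian matrix V*V. Then μ_k · μ_{n+1−k} = Q⁻² for every k = 1,…,n; in particular if n is odd then μ_{(n+1)/2} = Q⁻¹. -/
open Matrix
open scoped ComplexOrder

lemma aux_sorted {n : ℕ} (f g : Fin n → ℝ) (hf : Antitone f) (hg : Antitone g)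
    (h : Finset.univ.val.map f = Finset.univ.val.map g) : f = g := by
  have hp : (List.ofFn f).Perm (List.ofFn g) := by
    rw [← Multiset.coe_eq_coe]
    simpa [Fin.univ_val_map] using h
  have := hp.eq_of_sortedGE hf.sortedGE_ofFn hg.sortedGE_ofFn
  exact List.ofFn_injective this

lemma aux_char {n : ℕ} (A B : Matrix (Fin n) (Fin n) ℂ) (hA : A.IsHermitian) (c : ℝ)
    (hne : ∀ i, hA.eigenvalues i ≠ 0)
    (hAB : B * A = (c : ℂ) • 1) (hch : B.charpoly = A.charpoly) :
    Finset.univ.val.map hA.eigenvalues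
      = Finset.univ.val.map (fun i => c / hA.eigenvalues i) := by
  set U : Matrix (Fin n) (Fin n) ℂ := (hA.eigenvectorUnitary : Matrix (Fin n) (Fin n) ℂ) with hUdef
  have hU1 : star U * U = 1 := Unitary.coe_star_mul_self hA.eigenvectorUnitary
  have hU2 : U * star U = 1 := Unitary.coe_mul_star_self hA.eigenvectorUnitary
  have hsp : A = U * diagonal (fun i => ((hA.eigenvalues i : ℝ) : ℂ)) * star U := by
    have := hA.spectral_theorem
    rw [Unitary.conjStarAlgAut_apply] at this
    exact this
  have hAC : A * (U * diagonal (fun i => ((c / hA.eigenvalues i : ℝ) : ℂ)) * star U)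
      = (c : ℂ) • 1 := by
    have : diagonal (fun i => ((hA.eigenvalues i : ℝ) : ℂ))
        * diagonal (fun i => ((c / hA.eigenvalues i : ℝ) : ℂ)) = (c : ℂ) • 1 := by
      rw [diagonal_mul_diagonal, smul_one_eq_diagonal]
      congr 1
      funext i
      have : ((hA.eigenvalues i : ℝ) : ℂ) ≠ 0 := by exact_mod_cast hne i
      push_cast
      field_simp
    calc _ = (U * diagonal (fun i => ((hA.eigenvalues i : ℝ) : ℂ)) * star U) * (U * diagonal (fun i => ((c / hA.eigenvalues i : ℝ) : ℂ)) * star U) := by rw [← hsp]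
      _ = U * diagonal (fun i => ((hA.eigenvalues i : ℝ) : ℂ)) * (star U * U) * diagonal (fun i => ((c / hA.eigenvalues i : ℝ) : ℂ)) * star U := by simp only [Matrix.mul_assoc]
      _ = U * (diagonal (fun i => ((hA.eigenvalues i : ℝ) : ℂ)) * diagonal (fun i => ((c / hA.eigenvalues i : ℝ) : ℂ))) * star U := by rw [hU1]; simp only [Matrix.mul_assoc, Matrix.one_mul]
      _ = _ := by rw [this]; simp [hU2]
  by_cases hc : c = 0
  · subst hc
    have hdet : A.det ≠ 0 := by
      rw [hA.det_eq_prod_eigenvalues]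
      exact Finset.prod_ne_zero_iff.2 fun i _ => by
        have := hne i
        simpa using this
    have hB : B = 0 := by
      have : B * A * A⁻¹ = 0 := by rw [hAB]; simp
      rwa [Matrix.mul_nonsing_inv_cancel_right _ _ hdet.isUnit] at this
    subst hB
    rcases Nat.eq_zero_or_pos n with h0 | h0
    · subst h0; rfl
    · exfalso
      apply hdet
      have : NeZero n := ⟨h0.ne'⟩
      rw [det_eq_sign_charpoly_coeff, ← hch]
      simp [Matrix.charpoly_zero, h0.ne]
  have hc' : (c : ℂ) ≠ 0 := by exact_mod_cast hc
  have hB : B = U * diagonal (fun i => ((c / hA.eigenvalues i : ℝ) : ℂ)) * star U := by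
    have h := congrArg (B * ·) hAC
    simp only [← Matrix.mul_assoc B A, hAB] at h
    simp only [Matrix.smul_mul, Matrix.mul_smul, Matrix.one_mul, Matrix.mul_one] at h
    exact (smul_right_injective _ hc' h).symm
  have hBc : B.charpoly = ∏ i, (Polynomial.X - Polynomial.C ((c / hA.eigenvalues i : ℝ) : ℂ)) := by
    rw [hB, charpoly_mul_comm, ← Matrix.mul_assoc, hU1, Matrix.one_mul, charpoly_diagonal]
  have h1 := hA.roots_charpoly_eq_eigenvalues
  have h3 : (∏ i, (Polynomial.X - Polynomial.C ((c / hA.eigenvalues i : ℝ) : ℂ))).roots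
      = Finset.univ.val.map (fun i => ((c / hA.eigenvalues i : ℝ) : ℂ)) := by
    rw [Polynomial.roots_prod]
    · simp
    · simp [Finset.prod_ne_zero_iff, Polynomial.X_sub_C_ne_zero]
  rw [← hch, hBc, h3] at h1
  have h2 : (Finset.univ.val.map (fun i => c / hA.eigenvalues i)).map ((↑) : ℝ → ℂ)
    = (Finset.univ.val.map hA.eigenvalues).map ((↑) : ℝ → ℂ) := by
    simpa [Multiset.map_map, Function.comp_def] using h1
  exact (Multiset.map_injective Complex.ofReal_injective h2).symm

/-- if `Q·V·conj(V)` is unitary and `μ` lists the eigenvalues of the Hermitian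
matrix `V*V` in decreasing order, then `μ_k μ_{n+1-k} = Q⁻²` for all `k`, and for odd `n`
the middle eigenvalue equals `Q⁻¹`. -/
theorem stmt_3 (n : ℕ) (hn : 1 ≤ n) (Q : ℝ) (hQ : 0 < Q)
    (V : Matrix (Fin n) (Fin n) ℂ)
    (hU : (Q : ℂ) • (V * V.map (starRingEnd ℂ)) ∈ Matrix.unitaryGroup (Fin n) ℂ)
    (hH : (Vᴴ * V).IsHermitian)
    (μ : Fin n → ℝ) (hdec : Antitone μ)
    (e : Equiv.Perm (Fin n)) (hμ : μ = hH.eigenvalues ∘ e) :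
    (∀ k : Fin n, μ k * μ k.rev = (Q ^ 2)⁻¹) ∧
    (Odd n → μ ⟨n / 2, by omega⟩ = Q⁻¹) := by
  have hQc : (Q : ℂ) ≠ 0 := by exact_mod_cast hQ.ne'
  have hVm : V.map (starRingEnd ℂ) = Vᴴᵀ := by ext i j; simp
  have hct : (Vᴴᵀ)ᴴ = Vᵀ := by ext i j; simp
  rw [hVm, Matrix.mem_unitaryGroup_iff'] at hU
  rw [star_eq_conjTranspose, conjTranspose_smul, conjTranspose_mul, hct] at hU
  simp only [Matrix.smul_mul, Matrix.mul_smul, smul_smul, RCLike.star_def, Complex.conj_ofReal] at hU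
  have h1 : (((Q : ℂ) * Q) • Vᵀ) * ((Vᴴ * V) * Vᴴᵀ) = 1 := by
    rw [← hU]; simp only [Matrix.smul_mul, Matrix.mul_assoc]
  have h2 := mul_eq_one_comm.1 h1
  have h3 : (((Q : ℂ) * Q) • (Vᴴᵀ * Vᵀ)) * (Vᴴ * V) = 1 := by
    rw [mul_eq_one_comm]
    rw [← h2]; simp only [Matrix.mul_smul, Matrix.mul_assoc]
  have hAB : (V * Vᴴ)ᵀ * (Vᴴ * V) = (((Q ^ 2)⁻¹ : ℝ) : ℂ) • 1 := by
    rw [← h3, transpose_mul, Matrix.smul_mul, smul_smul]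
    have : (((Q ^ 2)⁻¹ : ℝ) : ℂ) * (Q * Q) = 1 := by push_cast; field_simp
    rw [this, one_smul]
  have hch : ((V * Vᴴ)ᵀ).charpoly = (Vᴴ * V).charpoly := by
    rw [charpoly_transpose, charpoly_mul_comm]
  have hdet : (Vᴴ * V).det ≠ 0 := by
    intro h
    have := congrArg det h3
    rw [det_mul, h] at this
    simp at this
  have hne : ∀ i, hH.eigenvalues i ≠ 0 := by
    rw [hH.det_eq_prod_eigenvalues] at hdet
    intro i h
    apply hdet
    exact Finset.prod_eq_zero (Finset.mem_univ i) (by simp [h])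
  have hpos : ∀ i, 0 < μ i := fun i => by
    rw [hμ]
    exact lt_of_le_of_ne ((posSemidef_conjTranspose_mul_self V).eigenvalues_nonneg _) (hne _).symm
  have hms := aux_char _ _ hH _ hne hAB hch
  have hperm : ∀ (f : Fin n → ℝ) (p : Equiv.Perm (Fin n)),
      Finset.univ.val.map (fun i => f (p i)) = Finset.univ.val.map f := by
    intro f p
    have := congrArg (Multiset.map f) (Multiset.map_univ_val_equiv p)
    rwa [Multiset.map_map] at this
  have hc0 : 0 < (Q ^ 2)⁻¹ := by positivity
  have key : μ = fun k => (Q ^ 2)⁻¹ / μ k.rev := by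
    apply aux_sorted _ _ hdec
    · intro a b hab
      exact div_le_div_of_nonneg_left hc0.le (hpos _) (hdec (Fin.rev_le_rev.2 hab))
    · refine Eq.trans ?_ (hperm (fun k => (Q ^ 2)⁻¹ / μ k) Fin.revPerm).symm
      rw [hμ]
      have a1 := hperm hH.eigenvalues e
      have a2 := hperm (fun i => (Q ^ 2)⁻¹ / hH.eigenvalues i) e
      exact a1.trans (hms.trans a2.symm)
  have main : ∀ k : Fin n, μ k * μ k.rev = (Q ^ 2)⁻¹ := by
    intro k
    have := congrFun key k
    rw [this, div_mul_cancel₀ _ (hpos _).ne']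
  refine ⟨main, fun hodd => ?_⟩
  have hm := main ⟨n / 2, by omega⟩
  have hr : (⟨n / 2, by omega⟩ : Fin n).rev = ⟨n / 2, by omega⟩ := by
    ext
    obtain ⟨m, rfl⟩ := hodd
    simp [Fin.rev]
    omega
  rw [hr, ← sq, ← inv_pow] at hm
  exact (pow_left_inj₀ (hpos _).le (inv_pos.2 hQ).le two_ne_zero).1 hm
end

section
/- Let n ≥ 1, Q > 0, and V ∈ M_n(ℂ) be such that W = Q·V·conj(V) is unitary. Then the characteristic polynomial of W has real coefficients (equivalently, the eigenvalues of W occur in complex-conjugate pairs with equal multiplicities), and if n is odd then 1 is an eigenvalue of W. -/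
open Matrix

/-- if `W = Q·V·conj(V)` is unitary then the characteristic polynomial of `W`
has real coefficients, and if `n` is odd then `1` is an eigenvalue of `W`. -/
theorem stmt_4 (n : ℕ) (hn : 1 ≤ n) (Q : ℝ) (hQ : 0 < Q)
    (V : Matrix (Fin n) (Fin n) ℂ)
    (W : Matrix (Fin n) (Fin n) ℂ)
    (hW : W = (Q : ℂ) • (V * V.map (starRingEnd ℂ)))
    (hU : W ∈ Matrix.unitaryGroup (Fin n) ℂ) :
    (∀ k : ℕ, (W.charpoly.coeff k).im = 0) ∧
    (Odd n → W.charpoly.eval 1 = 0) := by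
  have hmap : W.map (starRingEnd ℂ) = V.map (starRingEnd ℂ) * ((Q : ℂ) • V) := by
    rw [hW]
    ext i j
    simp [Matrix.mul_apply, Finset.mul_sum, mul_left_comm]
  have hp : W.charpoly.map (starRingEnd ℂ) = W.charpoly := by
    rw [← Matrix.charpoly_map, hmap, Matrix.charpoly_mul_comm, hW, Matrix.smul_mul]
  refine ⟨fun k => ?_, fun hodd => ?_⟩
  · rw [← Complex.conj_eq_iff_im]
    conv_rhs => rw [← hp]
    rw [Polynomial.coeff_map]
  · have hd : W.charpoly.eval 1 = (1 - W).det := by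
      rw [Matrix.eval_charpoly]; simp
    have hconj : starRingEnd ℂ (1 - W).det = (1 - W).det := by
      rw [← hd]
      conv_rhs => rw [← hp]
      have := Polynomial.eval_map_apply (starRingEnd ℂ) (p := W.charpoly) 1
      rw [map_one] at this
      exact this.symm
    have hstar : (1 - Wᴴ).det = (1 - W).det := by
      rw [← hconj]
      have : (1 - Wᴴ) = (1 - W)ᴴ := by simp
      rw [this, Matrix.det_conjTranspose]; rfl
    have hWW : W * Wᴴ = 1 := Matrix.mem_unitaryGroup_iff.mp hU
    have hr : W.det = ((Q ^ n * Complex.normSq V.det : ℝ) : ℂ) := by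
      have : (V.map (starRingEnd ℂ)).det = starRingEnd ℂ V.det :=
        ((starRingEnd ℂ).map_det V).symm
      rw [hW, Matrix.det_smul, Matrix.det_mul, this, Complex.mul_conj]
      simp
    have h1 : W.det = 1 := by
      have h2 := congrArg Matrix.det hWW
      rw [Matrix.det_mul, Matrix.det_conjTranspose, Matrix.det_one, hr] at h2
      have h0 : 0 ≤ Q ^ n * Complex.normSq V.det :=
        mul_nonneg (by positivity) (Complex.normSq_nonneg _)
      rw [hr]
      generalize Q ^ n * Complex.normSq V.det = r at *
      have h3 : r * r = 1 := by
        have h4 : ((r * r : ℝ) : ℂ) = 1 := by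
          rw [← h2]; simp
        exact_mod_cast h4
      have : r = 1 := by nlinarith
      simp [this]
    have h5 : (1 - W).det = - (1 - W).det := by
      have : 1 - W = W * (-(1 - Wᴴ)) := by
        rw [mul_neg, mul_sub, hWW]; simp
      conv_lhs => rw [this, Matrix.det_mul, h1, Matrix.det_neg, hstar]
      simp [hodd.neg_one_pow]
    rw [hd]
    exact self_eq_neg.mp h5
end

section
/- Let n ≥ 1, Q > 0, and suppose V₁, V₂ ∈ M_n(ℂ) satisfy the rank-two Temperley–Lieb equations with parameter Q. Suppose additionally that α·V₁·conj(V₁) is unitary for some α > 0 and that tr(V₁*V₁) = 1. Then α = √2·Q, Q ≥ n/√2, and there exist unitary matrices g, g' ∈ U(n) such that V₂ = V₁·g and V₂ = g'·V₁. -/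
open Matrix

/-- The rank-two Temperley–Lieb equations (E1)–(E3) for a pair of matrices with
parameter `Q`. -/
def TLPair {m : Type*} [Fintype m] [DecidableEq m] (Q : ℝ)
    (V₁ V₂ : Matrix m m ℂ) : Prop :=
  V₁ * V₁.map (starRingEnd ℂ) * V₁ᵀ * V₁ᴴ + V₂ * V₁.map (starRingEnd ℂ) * V₁ᵀ * V₂ᴴ
      = (Q ^ 2)⁻¹ • (1 : Matrix m m ℂ) ∧
  V₁ * V₂.map (starRingEnd ℂ) * V₂ᵀ * V₁ᴴ + V₂ * V₂.map (starRingEnd ℂ) * V₂ᵀ * V₂ᴴ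
      = (Q ^ 2)⁻¹ • (1 : Matrix m m ℂ) ∧
  V₁ * V₁.map (starRingEnd ℂ) * V₂ᵀ * V₁ᴴ + V₂ * V₁.map (starRingEnd ℂ) * V₂ᵀ * V₂ᴴ = 0

open scoped ComplexOrder in
lemma aux_psd {n : ℕ} (T : Matrix (Fin n) (Fin n) ℂ) (hT : T.PosSemidef)
    (hd : T.det = 1) (ht : T.trace = n) : T = 1 := by
  have h := hT.isHermitian
  have hd' : ∏ i, h.eigenvalues i = 1 := by
    have := h.det_eq_prod_eigenvalues
    rw [hd] at this
    have h2 : ((∏ i, h.eigenvalues i : ℝ) : ℂ) = 1 := by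
      push_cast; exact this.symm
    exact_mod_cast h2
  have ht' : ∑ i, h.eigenvalues i = n := by
    have := h.trace_eq_sum_eigenvalues
    rw [ht] at this
    have h2 : ((∑ i, h.eigenvalues i : ℝ) : ℂ) = n := by
      push_cast; exact this.symm
    exact_mod_cast h2
  have hne : ∀ i, h.eigenvalues i ≠ 0 := by
    intro i hi
    rw [Finset.prod_eq_zero (Finset.mem_univ i) hi] at hd'
    exact zero_ne_one hd'
  have hpos : ∀ i, 0 < h.eigenvalues i := fun i =>
    lt_of_le_of_ne (hT.eigenvalues_nonneg i) (hne i).symm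
  have hlog : ∑ i, Real.log (h.eigenvalues i) = 0 := by
    rw [← Real.log_prod (fun i _ => hne i), hd', Real.log_one]
  have hsum : ∑ i, (h.eigenvalues i - 1 - Real.log (h.eigenvalues i)) = 0 := by
    simp [Finset.sum_sub_distrib, hlog, ht']
  have hall := (Finset.sum_eq_zero_iff_of_nonneg (fun i _ => by
    have := Real.log_le_sub_one_of_pos (hpos i)
    linarith)).1 hsum
  have h1 : h.eigenvalues = fun _ => 1 := by
    funext i
    by_contra hc
    have h3 := Real.log_lt_sub_one_of_pos (hpos i) hc
    have h4 := hall i (Finset.mem_univ i)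
    linarith
  have hs := h.spectral_theorem
  rw [h1] at hs
  rw [hs]
  have : (diagonal ((RCLike.ofReal : ℝ → ℂ) ∘ (fun _ : Fin n => (1:ℝ)))) = 1 := by
    ext i j; simp [Matrix.one_apply, Matrix.diagonal_apply]
  rw [this, map_one]

open scoped ComplexOrder in
lemma aux_psd' {n : ℕ} (N : Matrix (Fin n) (Fin n) ℂ)
    (hd : (N * Nᴴ).det = 1) (ht : (N * Nᴴ).trace = n) : N * Nᴴ = 1 :=
  aux_psd _ (Matrix.posSemidef_self_mul_conjTranspose N) hd ht

open scoped ComplexOrder in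
lemma aux_tr {n : ℕ} (D : Matrix (Fin n) (Fin n) ℂ) (r : ℝ)
    (h : (D * Dᴴ).trace = (r : ℂ)) : 0 ≤ r := by
  have h0 := (Matrix.posSemidef_self_mul_conjTranspose D).trace_nonneg
  rw [h] at h0
  exact_mod_cast h0

open scoped ComplexOrder in
lemma aux_zero {n : ℕ} (X : Matrix (Fin n) (Fin n) ℂ) (h : X * Xᴴ = 0) : X = 0 :=
  Matrix.self_mul_conjTranspose_eq_zero.1 h

theorem stmt_6 (n : ℕ) (hn : 1 ≤ n) (Q : ℝ) (hQ : 0 < Q)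
    (V₁ V₂ : Matrix (Fin n) (Fin n) ℂ)
    (hTL : TLPair Q V₁ V₂)
    (α : ℝ) (hα : 0 < α)
    (hUni : (α : ℂ) • (V₁ * V₁.map (starRingEnd ℂ)) ∈ Matrix.unitaryGroup (Fin n) ℂ)
    (htr : (V₁ᴴ * V₁).trace = 1) :
    α = Real.sqrt 2 * Q ∧
    (n : ℝ) / Real.sqrt 2 ≤ Q ∧
    (∃ g ∈ Matrix.unitaryGroup (Fin n) ℂ, V₂ = V₁ * g) ∧
    (∃ g' ∈ Matrix.unitaryGroup (Fin n) ℂ, V₂ = g' * V₁) := by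
  obtain ⟨E1, E2, E3⟩ := hTL
  have hq : ∀ M : Matrix (Fin n) (Fin n) ℂ, (Q ^ 2)⁻¹ • M = (((Q:ℂ) ^ 2)⁻¹) • M := by
    intro M; ext i j; simp
  rw [hq] at E1 E2
  have hαc : (α:ℂ) ≠ 0 := by exact_mod_cast hα.ne'
  have hQc : (Q:ℂ) ≠ 0 := by exact_mod_cast hQ.ne'
  -- entrywise conjugation
  let cj : Matrix (Fin n) (Fin n) ℂ →+* Matrix (Fin n) (Fin n) ℂ := (starRingEnd ℂ).mapMatrix
  have hcj : ∀ M : Matrix (Fin n) (Fin n) ℂ, M.map (starRingEnd ℂ) = cj M := fun M => rfl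
  have hcc : ∀ M, cj (cj M) = M := by intro M; ext i j; simp [cj]
  have hT : ∀ M : Matrix (Fin n) (Fin n) ℂ, Mᵀ = (cj M)ᴴ := by
    intro M; ext i j; simp [cj]
  have hcH : ∀ M : Matrix (Fin n) (Fin n) ℂ, cj (Mᴴ) = (cj M)ᴴ := by
    intro M; ext i j; simp [cj]
  have hcs : ∀ M : Matrix (Fin n) (Fin n) ℂ, cj ((α:ℂ) • M) = (α:ℂ) • cj M := by
    intro M; ext i j; simp [cj]
  simp only [hcj, hT] at E1 E2 E3 hUni
  generalize hA : V₁ = A at *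
  generalize hB : V₂ = B at *
  obtain ⟨U, hU⟩ : ∃ U, U = (α:ℂ) • (A * cj A) := ⟨_, rfl⟩
  rw [← hU] at hUni
  have hU1 : U * Uᴴ = 1 := Matrix.mem_unitaryGroup_iff.1 hUni
  have hU2 : Uᴴ * U = 1 := Matrix.mem_unitaryGroup_iff'.1 hUni
  have hAC : A * cj A = (α:ℂ)⁻¹ • U := by rw [hU, smul_smul, inv_mul_cancel₀ hαc, one_smul]
  have hACH : (cj A)ᴴ * Aᴴ = (α:ℂ)⁻¹ • Uᴴ := by
    rw [← conjTranspose_mul, hAC, conjTranspose_smul]; simp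
  obtain ⟨Ai, hAi⟩ : ∃ Ai, Ai = (α:ℂ) • (cj A * Uᴴ) := ⟨_, rfl⟩
  have hA1 : A * Ai = 1 := by
    rw [hAi, mul_smul_comm, ← mul_assoc, ← smul_mul_assoc, ← hU, hU1]
  have hA2 : Ai * A = 1 := mul_eq_one_comm.1 hA1
  obtain ⟨X, hX⟩ : ∃ X, X = B * Ai := ⟨_, rfl⟩
  have hBX : B = X * A := by rw [hX, mul_assoc, hA2, mul_one]
  obtain ⟨k, hk⟩ : ∃ k : ℂ, k = α^2 * ((Q:ℂ)^2)⁻¹ - 1 := ⟨_, rfl⟩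
  have e1 : A * cj A * (cj A)ᴴ * Aᴴ = ((α:ℂ)^2)⁻¹ • (1 : Matrix (Fin n) (Fin n) ℂ) := by
    rw [mul_assoc, hACH, hAC, smul_mul_smul_comm, hU1, ← mul_inv, sq]
  have e2 : B * cj A * (cj A)ᴴ * Bᴴ = ((α:ℂ)^2)⁻¹ • (X * Xᴴ) := by
    calc _ = X * (A * cj A * (cj A)ᴴ * Aᴴ) * Xᴴ := by
          rw [hBX, conjTranspose_mul]; simp only [mul_assoc]
      _ = _ := by rw [e1]; simp
  have hXX : X * Xᴴ = k • (1 : Matrix (Fin n) (Fin n) ℂ) := by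
    rw [e1, e2] at E1
    have := congrArg (fun M => ((α:ℂ)^2) • M) E1
    simp only [smul_add, smul_smul] at this
    rw [mul_inv_cancel₀ (pow_ne_zero 2 hαc), one_smul, one_smul] at this
    rw [hk, sub_smul, one_smul, ← this]; abel
  have hn0 : n ≠ 0 := by omega
  have : Nonempty (Fin n) := ⟨⟨0, by omega⟩⟩
  have hk0 : k ≠ 0 := by
    intro h0
    rw [h0, zero_smul] at hXX
    have hX0 : X = 0 := aux_zero X hXX
    rw [hBX, hX0] at E2
    have h1 := congrFun (congrFun E2 ⟨0, by omega⟩) ⟨0, by omega⟩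
    simp at h1
    exact pow_ne_zero 2 hQc h1.symm
  have hdX : X.det * Xᴴ.det = k ^ n := by
    rw [← det_mul, hXX, det_smul]; simp
  have hdX0 : X.det ≠ 0 := by
    intro h0; rw [h0, zero_mul] at hdX; exact pow_ne_zero n hk0 hdX.symm
  have hdA0 : A.det ≠ 0 := by
    intro h0
    have := congrArg det hA1
    rw [det_mul, h0] at this; simp at this
  have hdc : ∀ M, (cj M).det = (starRingEnd ℂ) M.det := fun M => ((starRingEnd ℂ).map_det M).symm
  obtain ⟨M, hM⟩ : ∃ M, M = A * cj A * (cj B)ᴴ * Aᴴ := ⟨_, rfl⟩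
  have hMX : B * cj A * (cj B)ᴴ * Bᴴ = X * M * Xᴴ := by
    rw [hM]
    nth_rw 1 [hBX]
    nth_rw 2 [hBX]
    rw [conjTranspose_mul]; simp only [mul_assoc]
  have hdM0 : M.det ≠ 0 := by
    rw [hM, hBX]
    simp [det_mul, det_conjTranspose, hdc, hdA0, hdX0]
  have hkn : ‖k‖ ^ n = 1 := by
    rw [hMX, ← hM] at E3
    have h1 : M = -(X * M * Xᴴ) := eq_neg_of_add_eq_zero_left E3
    have h2 := congrArg det h1
    rw [det_neg, det_mul, det_mul] at h2
    have h3 : M.det * 1 = M.det * ((-1)^n * k^n) := by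
      rw [← hdX]; simp only [Fintype.card_fin] at h2; rw [mul_one]
      nth_rw 1 [h2]; ring
    have h4 := mul_left_cancel₀ hdM0 h3
    have h5 := congrArg norm h4
    simpa using h5.symm
  have hkn1 : ‖k‖ = 1 := (pow_eq_one_iff_of_nonneg (norm_nonneg k) hn0).1 hkn
  have hkr : k = ((α^2 * (Q^2)⁻¹ - 1 : ℝ) : ℂ) := by rw [hk]; push_cast; rfl
  have hkr2 : α^2 * (Q^2)⁻¹ = 2 := by
    rw [hkr, Complex.norm_real, Real.norm_eq_abs] at hkn1
    have : 0 < α^2 * (Q^2)⁻¹ := by positivity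
    rcases (abs_eq zero_le_one).1 hkn1 with h | h <;> linarith
  have hα2 : α^2 = 2 * Q^2 := by
    field_simp at hkr2; linarith
  have hkone : k = 1 := by rw [hkr, hkr2]; norm_num
  have hαQ : α = Real.sqrt 2 * Q := by
    have : α^2 = (Real.sqrt 2 * Q)^2 := by rw [mul_pow, Real.sq_sqrt (by norm_num)]; exact hα2
    exact (pow_left_inj₀ hα.le (by positivity) two_ne_zero).1 this
  rw [hkone, one_smul] at hXX
  have hXX' : Xᴴ * X = 1 := mul_eq_one_comm.1 hXX
  refine ⟨hαQ, ?_, ?_, ⟨X, Matrix.mem_unitaryGroup_iff.2 hXX, hBX⟩⟩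
  · -- the trace inequality
    have hnα : (n:ℝ) ≤ α := by
      let D := A - (cj A * Uᴴ)ᴴ
      have hAA : (A * Aᴴ).trace = 1 := by rw [trace_mul_comm]; exact htr
      have hCC : ((cj A)ᴴ * cj A).trace = 1 := by
        have : (cj A)ᴴ * cj A = cj (Aᴴ * A) := by rw [map_mul, hcH]
        rw [this]
        have h2 : (cj (Aᴴ * A)).trace = (starRingEnd ℂ) (Aᴴ * A).trace := by
          generalize Aᴴ * A = W
          simp [cj, Matrix.trace, map_sum]
        rw [h2, htr, map_one]
      have hX1 : A * (cj A * Uᴴ) = (α:ℂ)⁻¹ • (1 : Matrix (Fin n) (Fin n) ℂ) := by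
        rw [← mul_assoc, hAC, smul_mul_assoc, hU1]
      have hX2 : (cj A * Uᴴ)ᴴ * Aᴴ = (α:ℂ)⁻¹ • (1 : Matrix (Fin n) (Fin n) ℂ) := by
        rw [← conjTranspose_mul, hX1, conjTranspose_smul]; simp
      have hX3 : ((cj A * Uᴴ)ᴴ * (cj A * Uᴴ)).trace = 1 := by
        rw [conjTranspose_mul, conjTranspose_conjTranspose, trace_mul_comm,
          ← hCC, trace_mul_comm (cj A)ᴴ]
        congr 1
        calc _ = cj A * (Uᴴ * U) * (cj A)ᴴ := by simp only [mul_assoc]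
          _ = _ := by rw [hU2, mul_one]
      have h1 : (D * Dᴴ).trace = ((2 - 2 * (n * α⁻¹) : ℝ) : ℂ) := by
        simp only [D]
        rw [conjTranspose_sub, conjTranspose_conjTranspose, sub_mul, mul_sub, mul_sub,
          hX1, hX2]
        simp only [trace_sub, hAA, hX3, trace_smul, trace_one, Fintype.card_fin, smul_eq_mul]
        push_cast; ring
      have h2 : (0:ℝ) ≤ 2 - 2 * (n * α⁻¹) := aux_tr D _ h1
      have h3 : n * α⁻¹ ≤ 1 := by linarith
      rwa [← div_eq_mul_inv, div_le_one hα] at h3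
    rw [div_le_iff₀ (by positivity)]
    linarith
  · -- right unitary
    obtain ⟨N, hN⟩ : ∃ N, N = (α:ℂ) • (A * cj B) := ⟨_, rfl⟩
    have hNH : Nᴴ = (α:ℂ) • ((cj B)ᴴ * Aᴴ) := by
      rw [hN, conjTranspose_smul, conjTranspose_mul]; simp
    have hNN : N * Nᴴ = (α:ℂ)^2 • (A * cj B * (cj B)ᴴ * Aᴴ) := by
      rw [hNH, hN, smul_mul_smul_comm, sq]; simp only [mul_assoc]
    have hsum : N * Nᴴ + X * (N * Nᴴ) * Xᴴ = (2:ℂ) • (1 : Matrix (Fin n) (Fin n) ℂ) := by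
      have h1 : X * (N * Nᴴ) * Xᴴ = (α:ℂ)^2 • (B * cj B * (cj B)ᴴ * Bᴴ) := by
        have : B * cj B * (cj B)ᴴ * Bᴴ = X * (A * cj B * (cj B)ᴴ * Aᴴ) * Xᴴ := by
          nth_rw 1 [hBX]
          nth_rw 3 [hBX]
          rw [conjTranspose_mul]; simp only [mul_assoc]
        rw [this, hNN]; simp
      rw [h1, hNN, ← smul_add, E2, smul_smul]
      congr 1
      exact_mod_cast hkr2
    have htN : (N * Nᴴ).trace = n := by
      have h1 := congrArg trace hsum
      have h2 : (X * (N * Nᴴ) * Xᴴ).trace = (N * Nᴴ).trace := by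
        rw [trace_mul_comm, ← mul_assoc, hXX', one_mul]
      rw [trace_add, h2, trace_smul, trace_one, Fintype.card_fin, smul_eq_mul] at h1
      linear_combination h1 / 2
    have hdU : ∀ W : Matrix (Fin n) (Fin n) ℂ, W * Wᴴ = 1 → W.det * (starRingEnd ℂ) W.det = 1 := by
      intro W hW
      have := congrArg det hW
      rw [det_mul, det_conjTranspose, det_one] at this
      exact this
    have hdN : (N * Nᴴ).det = 1 := by
      have h1 : N.det = U.det * (starRingEnd ℂ) X.det := by
        rw [hN, hU, hBX, map_mul, det_smul, det_smul, det_mul, det_mul, det_mul, hdc X]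
        ring
      rw [det_mul, det_conjTranspose]
      change N.det * (starRingEnd ℂ) N.det = 1
      rw [h1, map_mul, Complex.conj_conj]
      linear_combination (X.det * (starRingEnd ℂ) X.det) * hdU U hU1 + hdU X hXX
    have hN1 : N * Nᴴ = 1 :=
      aux_psd' N hdN htN
    have hcN : cj N * (cj N)ᴴ = 1 := by rw [← hcH, ← map_mul, hN1, map_one]
    have hcU : cj U * (cj U)ᴴ = 1 := by rw [← hcH, ← map_mul, hU1, map_one]
    have hcU' : (cj U)ᴴ * cj U = 1 := mul_eq_one_comm.1 hcU
    have hcU2 : cj U = (α:ℂ) • (cj A * A) := by rw [hU, hcs, map_mul, hcc]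
    have hcN2 : cj N = (α:ℂ) • (cj A * B) := by rw [hN, hcs, map_mul, hcc]
    refine ⟨(cj U)ᴴ * cj N, ?_, ?_⟩
    · rw [Matrix.mem_unitaryGroup_iff, star_eq_conjTranspose, conjTranspose_mul,
        conjTranspose_conjTranspose]
      calc _ = (cj U)ᴴ * (cj N * (cj N)ᴴ) * cj U := by simp only [mul_assoc]
        _ = 1 := by rw [hcN, mul_one, hcU']
    · have h1 : ((α:ℂ) • ((cj U)ᴴ * cj A)) * A = 1 := by
        rw [smul_mul_assoc, mul_assoc, ← mul_smul_comm, ← hcU2, hcU']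
      have h2 := mul_eq_one_comm.1 h1
      calc B = (A * ((α:ℂ) • ((cj U)ᴴ * cj A))) * B := by rw [h2, one_mul]
        _ = _ := by rw [hcN2]; simp [mul_assoc]
end

section
/- Let n ≥ 1, Q > 0, and suppose V₁, V₂ ∈ M_n(ℂ) satisfy the rank-two Temperley–Lieb equations with parameter Q. Suppose additionally that α·V₁·conj(V₁) is unitary for some α > 0 and that tr(V₁*V₁) = 1. Then the matrices α·V₂·conj(V₁), α·V₁·conj(V₂), and α·V₂·conj(V₂) are all unitary, and moreover tr(V₂*V₂) = 1 and tr(V₁*V₂) = 0. -/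
open Matrix

theorem aux_comm {m : Type*} [Fintype m] [DecidableEq m] {X Y Z : Matrix m m ℂ} {a c : ℂ}
    (ha : a ≠ 0) (hZ : X * Z = a • (1 : Matrix m m ℂ))
    (h : X * Y = c • (1 : Matrix m m ℂ)) : Y * X = c • (1 : Matrix m m ℂ) := by
  have h1 : X * (a⁻¹ • Z) = 1 := by
    rw [Matrix.mul_smul, hZ, smul_smul, inv_mul_cancel₀ ha, one_smul]
  have h2 : (a⁻¹ • Z) * X = 1 := mul_eq_one_comm.mp h1
  calc Y * X = ((a⁻¹ • Z) * X) * Y * X := by rw [h2, one_mul]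
    _ = (a⁻¹ • Z) * (X * Y) * X := by simp only [mul_assoc]
    _ = c • ((a⁻¹ • Z) * X) := by rw [h, Matrix.mul_smul, mul_one, Matrix.smul_mul]
    _ = c • (1 : Matrix m m ℂ) := by rw [h2]

theorem aux_cancel {m : Type*} [Fintype m] [DecidableEq m] {X Y Z W : Matrix m m ℂ} {a : ℂ}
    (ha : a ≠ 0) (hZ : X * Z = a • (1 : Matrix m m ℂ)) (h : X * Y = X * W) : Y = W := by
  have h2 := aux_comm ha hZ hZ
  have : Z * (X * Y) = Z * (X * W) := by rw [h]
  rw [← mul_assoc, ← mul_assoc, h2, Matrix.smul_mul, Matrix.smul_mul, one_mul, one_mul] at this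
  exact smul_right_injective _ ha this

theorem aux_unitary {m : Type*} [Fintype m] [DecidableEq m] (α : ℝ) (hα : 0 < α)
    (X : Matrix m m ℂ) : (α : ℂ) • X ∈ Matrix.unitaryGroup m ℂ ↔
      X * Xᴴ = (((α : ℂ) ^ 2)⁻¹) • (1 : Matrix m m ℂ) := by
  have h0 : (α : ℂ) ≠ 0 := by exact_mod_cast hα.ne'
  have h1 : (α : ℂ) ^ 2 ≠ 0 := pow_ne_zero _ h0
  rw [Matrix.mem_unitaryGroup_iff, star_eq_conjTranspose, conjTranspose_smul, Matrix.smul_mul,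
    Matrix.mul_smul, smul_smul]
  have : (α : ℂ) * star (α : ℂ) = (α : ℂ) ^ 2 := by
    simp [pow_two]
  rw [this, eq_inv_smul_iff₀ h1]

/-- rows orthogonal imply columns orthogonal -/
theorem aux_block {m : Type*} [Fintype m] [DecidableEq m] {P R S T : Matrix m m ℂ} {q : ℂ}
    (hq : q ≠ 0) (hqs : star q = q)
    (h1 : P * Pᴴ + R * Rᴴ = q • (1 : Matrix m m ℂ))
    (h2 : S * Sᴴ + T * Tᴴ = q • (1 : Matrix m m ℂ))
    (h3 : P * Sᴴ + R * Tᴴ = 0) :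
    Pᴴ * P + Sᴴ * S = q • (1 : Matrix m m ℂ) := by
  have h4 : S * Pᴴ + T * Rᴴ = 0 := by
    have := congrArg conjTranspose h3
    simpa using this
  have hM : fromBlocks P R S T * (fromBlocks P R S T)ᴴ
      = q • (1 : Matrix (m ⊕ m) (m ⊕ m) ℂ) := by
    rw [fromBlocks_conjTranspose, fromBlocks_multiply, h1, h2, h3, h4, ← fromBlocks_one,
      fromBlocks_smul, smul_zero]
  have hM2 := aux_comm hq hM hM
  rw [fromBlocks_conjTranspose, fromBlocks_multiply, ← fromBlocks_one, fromBlocks_smul,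
    fromBlocks_inj] at hM2
  exact hM2.1

theorem aux_main {m : Type*} [Fintype m] [DecidableEq m] (A B Ac Bc : Matrix m m ℂ) (q a : ℂ)
    (hAc : Acᴴ = Aᵀ) (hBc : Bcᴴ = Bᵀ) (hAc' : Acᵀ = Aᴴ) (hBc' : Bcᵀ = Bᴴ)
    (hq : q ≠ 0) (ha : a ≠ 0) (hqs : star q = q)
    (E1 : A * Ac * (A * Ac)ᴴ + B * Ac * (B * Ac)ᴴ = q • (1 : Matrix m m ℂ))
    (E2 : A * Bc * (A * Bc)ᴴ + B * Bc * (B * Bc)ᴴ = q • (1 : Matrix m m ℂ))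
    (E3 : A * Ac * (A * Bc)ᴴ + B * Ac * (B * Bc)ᴴ = 0)
    (hU : A * Ac * (A * Ac)ᴴ = a • (1 : Matrix m m ℂ))
    (htr : (Aᴴ * A).trace = 1) :
    B * Ac * (B * Ac)ᴴ = a • (1 : Matrix m m ℂ) ∧
    A * Bc * (A * Bc)ᴴ = a • (1 : Matrix m m ℂ) ∧
    B * Bc * (B * Bc)ᴴ = a • (1 : Matrix m m ℂ) ∧
    (Bᴴ * B).trace = 1 ∧ (Aᴴ * B).trace = 0 := by
  have hcol := aux_block hq hqs E1 E2 E3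
  obtain ⟨c, hc⟩ : ∃ c, c = q - a := ⟨_, rfl⟩
  have w11 : (A * Ac)ᴴ * (A * Ac) = a • (1 : Matrix m m ℂ) := aux_comm ha hU hU
  have w21 : B * Ac * (B * Ac)ᴴ = c • (1 : Matrix m m ℂ) := by
    rw [hc, sub_smul, ← E1, ← hU]; abel
  have w12' : (A * Bc)ᴴ * (A * Bc) = c • (1 : Matrix m m ℂ) := by
    rw [hc, sub_smul, ← hcol, ← w11]; abel
  have hAunit : A * (Ac * (A * Ac)ᴴ) = a • (1 : Matrix m m ℂ) := by rw [← hU, mul_assoc]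
  have hW : ∀ {X : Matrix m m ℂ}, Xᴴ * X = c • (1 : Matrix m m ℂ) →
      X * Xᴴ = c • (1 : Matrix m m ℂ) := by
    intro X hX
    by_cases h0 : c = 0
    · rw [h0, zero_smul] at hX ⊢
      have : X = 0 := by
        open scoped ComplexOrder in
        exact Matrix.conjTranspose_mul_self_eq_zero.mp hX
      simp [this]
    · exact aux_comm h0 hX hX
  have w12 := hW w12'
  have w22 : B * Bc * (B * Bc)ᴴ = a • (1 : Matrix m m ℂ) := by
    have : a • (1 : Matrix m m ℂ) = q • (1 : Matrix m m ℂ) - c • (1 : Matrix m m ℂ) := by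
      rw [← sub_smul, hc]; congr 1; ring
    rw [this, ← E2, ← w12]; abel
  have hBunit : B * (Bc * (B * Bc)ᴴ) = a • (1 : Matrix m m ℂ) := by rw [← w22, mul_assoc]
  obtain ⟨K, hK⟩ : ∃ K, K = Ac * Aᵀ := ⟨_, rfl⟩
  obtain ⟨L, hL⟩ : ∃ L, L = Bc * Bᵀ := ⟨_, rfl⟩
  obtain ⟨H, hH⟩ : ∃ H, H = Aᴴ * A := ⟨_, rfl⟩
  obtain ⟨G, hG⟩ : ∃ G, G = Bᴴ * B := ⟨_, rfl⟩
  have KH : K * H = a • (1 : Matrix m m ℂ) := by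
    rw [hH, ← mul_assoc]; refine aux_comm ha hAunit ?_
    rw [← hU, hK, conjTranspose_mul, hAc]; simp only [mul_assoc]
  have KG : K * G = c • (1 : Matrix m m ℂ) := by
    rw [hG, ← mul_assoc]; refine aux_comm ha hBunit ?_
    rw [← w21, hK, conjTranspose_mul, hAc]; simp only [mul_assoc]
  have LH : L * H = c • (1 : Matrix m m ℂ) := by
    rw [hH, ← mul_assoc]; refine aux_comm ha hAunit ?_
    rw [← w12, hL, conjTranspose_mul, hBc]; simp only [mul_assoc]
  have LG : L * G = a • (1 : Matrix m m ℂ) := by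
    rw [hG, ← mul_assoc]; refine aux_comm ha hBunit ?_
    rw [← w22, hL, conjTranspose_mul, hBc]; simp only [mul_assoc]
  have e1 : a • G = c • H := by
    refine aux_cancel ha KH ?_
    rw [Matrix.mul_smul, Matrix.mul_smul, KG, KH, smul_smul, smul_smul, mul_comm]
  have e2 : c • G = a • H := by
    refine aux_cancel ha LG ?_
    rw [Matrix.mul_smul, Matrix.mul_smul, LG, LH, smul_smul, smul_smul, mul_comm]
  have t1 : a * G.trace = c := by
    have := congrArg trace e1
    rw [trace_smul, trace_smul, hH, htr] at this; simpa using this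
  have t2 : c * G.trace = a := by
    have := congrArg trace e2
    rw [trace_smul, trace_smul, hH, htr] at this; simpa using this
  have hca : c = a := by
    have h : (c - a) * q = 0 := by
      have : q = c + a := by rw [hc]; ring
      rw [this]; linear_combination a * t2 - c * t1
    rcases mul_eq_zero.mp h with h | h
    · exact sub_eq_zero.mp h
    · exact absurd h hq
  rw [hca] at w21 w12 e1 LH KG t1
  have hGH : G = H := smul_right_injective _ ha e1
  have HK := aux_comm ha KH KH
  have HL : H * L = a • (1 : Matrix m m ℂ) := aux_comm ha LH LH
  have hLK : L = K := aux_cancel ha HK (by rw [HK, HL])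
  refine ⟨w21, w12, w22, by rw [← hG, hGH, hH, htr], ?_⟩
  -- inverse of A
  obtain ⟨Ai, hAi⟩ : ∃ Ai, A * Ai = 1 := by
    refine ⟨a⁻¹ • (Ac * (A * Ac)ᴴ), ?_⟩
    rw [Matrix.mul_smul, hAunit, smul_smul, inv_mul_cancel₀ ha, one_smul]
  have hAi' : Ai * A = 1 := mul_eq_one_comm.mp hAi
  obtain ⟨S, hS⟩ : ∃ S, S = Ai * B := ⟨_, rfl⟩
  obtain ⟨U, hUd⟩ : ∃ U, U = B * Ai := ⟨_, rfl⟩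
  have BS : B = A * S := by rw [hS, ← mul_assoc, hAi, one_mul]
  have BU : B = U * A := by rw [hUd, mul_assoc, hAi', mul_one]
  have hAAs : Ai * A * (Aᴴ * Aiᴴ) = 1 := by
    rw [hAi', ← conjTranspose_mul, hAi', conjTranspose_one, one_mul]
  have hAiH : Aᴴ * Aiᴴ = 1 := by rw [← conjTranspose_mul, hAi', conjTranspose_one]
  have hAiH' : Aiᴴ * Aᴴ = 1 := by rw [← conjTranspose_mul, hAi, conjTranspose_one]
  have BB : B * Bᴴ = A * Aᴴ := by
    have := congrArg transpose hLK
    rw [hL, hK, transpose_mul, transpose_mul, transpose_transpose, transpose_transpose, hAc',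
      hBc'] at this
    exact this
  have BB' : Bᴴ * B = Aᴴ * A := by rw [← hG, ← hH, hGH]
  have SS : S * Sᴴ = 1 := by
    rw [hS, conjTranspose_mul]
    calc Ai * B * (Bᴴ * Aiᴴ) = Ai * (B * Bᴴ) * Aiᴴ := by simp only [mul_assoc]
      _ = 1 := by rw [BB, ← hAAs]; simp only [mul_assoc]
  have SS' : Sᴴ * S = 1 := mul_eq_one_comm.mp SS
  have UU : Uᴴ * U = 1 := by
    rw [hUd, conjTranspose_mul]
    calc Aiᴴ * Bᴴ * (B * Ai) = Aiᴴ * (Bᴴ * B) * Ai := by simp only [mul_assoc]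
      _ = (Aiᴴ * Aᴴ) * (A * Ai) := by rw [BB']; simp only [mul_assoc]
      _ = 1 := by rw [hAiH', hAi, one_mul]
  have UU' : U * Uᴴ = 1 := mul_eq_one_comm.mp UU
  -- S commutes with H
  have SH : S * H = H * S := by
    have h : Sᴴ * H * S = H := by
      rw [hH]
      calc Sᴴ * (Aᴴ * A) * S = (A * S)ᴴ * (A * S) := by
            rw [conjTranspose_mul]; simp only [mul_assoc]
        _ = Aᴴ * A := by rw [← BS, BB']
    calc S * H = S * (Sᴴ * H * S) := by rw [h]
      _ = (S * Sᴴ) * (H * S) := by simp only [mul_assoc]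
      _ = H * S := by rw [SS, one_mul]
  have comm_K : ∀ X : Matrix m m ℂ, X * H = H * X → X * K = K * X := by
    intro X hX
    have : a • (X * K) = a • (K * X) := by
      calc a • (X * K) = (K * H) * (X * K) := by rw [KH, Matrix.smul_mul, one_mul]
        _ = K * (H * X) * K := by simp only [mul_assoc]
        _ = K * X * (H * K) := by rw [← hX]; simp only [mul_assoc]
        _ = a • (K * X) := by rw [HK, Matrix.mul_smul, mul_one]
    exact smul_right_injective _ ha this
  have SK := comm_K S SH
  have UA : U * (A * Aᴴ) = (A * Aᴴ) * U := by
    have h : U * (A * Aᴴ) * Uᴴ = A * Aᴴ := by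
      calc U * (A * Aᴴ) * Uᴴ = (U * A) * (U * A)ᴴ := by
            rw [conjTranspose_mul]; simp only [mul_assoc]
        _ = A * Aᴴ := by rw [← BU, BB]
    calc U * (A * Aᴴ) = U * (A * Aᴴ) * (Uᴴ * U) := by rw [UU, mul_one]
      _ = (U * (A * Aᴴ) * Uᴴ) * U := by simp only [mul_assoc]
      _ = _ := by rw [h]
  have KT : K * Uᵀ = Uᵀ * K := by
    have := congrArg transpose UA
    rw [transpose_mul, transpose_mul, transpose_mul, ← hAc', transpose_mul,
      transpose_transpose, ← hK] at this
    exact this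
  have HT : H * Uᵀ = Uᵀ * H := by
    have : a • (H * Uᵀ) = a • (Uᵀ * H) := by
      calc a • (H * Uᵀ) = H * Uᵀ * (K * H) := by rw [KH, Matrix.mul_smul, mul_one]
        _ = H * (Uᵀ * K) * H := by simp only [mul_assoc]
        _ = (H * K) * (Uᵀ * H) := by rw [← KT]; simp only [mul_assoc]
        _ = a • (Uᵀ * H) := by rw [HK, Matrix.smul_mul, one_mul]
    exact smul_right_injective _ ha this
  have Y : Ac * Bᵀ = K * Uᵀ := by
    rw [hK, BU, transpose_mul, mul_assoc]
  have E3' : A * (K * Uᵀ) * Aᴴ + B * (K * Uᵀ) * Bᴴ = 0 := by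
    rw [← Y, ← E3, conjTranspose_mul, conjTranspose_mul, hBc]; simp only [mul_assoc]
  have F : K * Uᵀ + S * (K * Uᵀ) * Sᴴ = 0 := by
    calc K * Uᵀ + S * (K * Uᵀ) * Sᴴ
        = (Ai * A) * (K * Uᵀ) * (Aᴴ * Aiᴴ) + S * (K * Uᵀ) * Sᴴ := by
          rw [hAi', hAiH, one_mul, mul_one]
      _ = Ai * (A * (K * Uᵀ) * Aᴴ + B * (K * Uᵀ) * Bᴴ) * Aiᴴ := by
          rw [hS, conjTranspose_mul, mul_add, add_mul]; simp only [mul_assoc]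
      _ = 0 := by rw [E3', mul_zero, zero_mul]
  have F2 : K * (Uᵀ * S) = K * (-(S * Uᵀ)) := by
    have h : (K * Uᵀ + S * (K * Uᵀ) * Sᴴ) * S = 0 := by rw [F, zero_mul]
    rw [add_mul, mul_assoc _ Sᴴ S, SS', mul_one, ← mul_assoc S K, SK] at h
    rw [mul_neg, ← mul_assoc, ← mul_assoc]
    exact eq_neg_of_add_eq_zero_left h
  have F3 : Uᵀ * S = -(S * Uᵀ) := aux_cancel ha KH F2
  have TT : Uᵀ * (Uᴴ)ᵀ = 1 := by rw [← transpose_mul, UU, transpose_one]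
  have hAB : Aᴴ * B = H * S := by rw [hH, mul_assoc, ← BS]
  have tt : (H * S).trace = -(H * S).trace := by
    calc (H * S).trace = (H * S * (Uᵀ * (Uᴴ)ᵀ)).trace := by rw [TT, mul_one]
      _ = (H * (S * Uᵀ) * (Uᴴ)ᵀ).trace := by simp only [mul_assoc]
      _ = (-((H * Uᵀ) * S * (Uᴴ)ᵀ)).trace := by
          rw [← neg_neg (S * Uᵀ), ← F3, mul_neg, neg_mul]; simp only [mul_assoc]
      _ = -((Uᵀ * (H * S * (Uᴴ)ᵀ)).trace) := by
          rw [HT, trace_neg]; simp only [mul_assoc]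
      _ = -(H * S).trace := by
          rw [trace_mul_comm, mul_assoc, mul_eq_one_comm.mp TT, mul_one]
  rw [hAB]
  exact self_eq_neg.mp tt

/-- if `(V₁, V₂)` satisfies the rank-two TL equations, `α·V₁·conj(V₁)` is
unitary for some `α > 0` and `tr(V₁*V₁) = 1`, then the matrices `α·V₂·conj(V₁)`,
`α·V₁·conj(V₂)`, `α·V₂·conj(V₂)` are unitary and `tr(V₂*V₂) = 1`, `tr(V₁*V₂) = 0`. -/
theorem stmt_7 (n : ℕ) (hn : 1 ≤ n) (Q : ℝ) (hQ : 0 < Q)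
    (V₁ V₂ : Matrix (Fin n) (Fin n) ℂ)
    (hTL : TLPair Q V₁ V₂)
    (α : ℝ) (hα : 0 < α)
    (hUni : (α : ℂ) • (V₁ * V₁.map (starRingEnd ℂ)) ∈ Matrix.unitaryGroup (Fin n) ℂ)
    (htr : (V₁ᴴ * V₁).trace = 1) :
    (α : ℂ) • (V₂ * V₁.map (starRingEnd ℂ)) ∈ Matrix.unitaryGroup (Fin n) ℂ ∧
    (α : ℂ) • (V₁ * V₂.map (starRingEnd ℂ)) ∈ Matrix.unitaryGroup (Fin n) ℂ ∧
    (α : ℂ) • (V₂ * V₂.map (starRingEnd ℂ)) ∈ Matrix.unitaryGroup (Fin n) ℂ ∧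
    (V₂ᴴ * V₂).trace = 1 ∧
    (V₁ᴴ * V₂).trace = 0 := by
  obtain ⟨E1, E2, E3⟩ := hTL
  have hc1 : ∀ V : Matrix (Fin n) (Fin n) ℂ, (V.map (starRingEnd ℂ))ᴴ = Vᵀ := by
    intro V; ext i j; simp
  have hc2 : ∀ V : Matrix (Fin n) (Fin n) ℂ, (V.map (starRingEnd ℂ))ᵀ = Vᴴ := by
    intro V; ext i j; simp
  have hq : (Q ^ 2)⁻¹ • (1 : Matrix (Fin n) (Fin n) ℂ)
      = (((Q : ℂ) ^ 2)⁻¹) • (1 : Matrix (Fin n) (Fin n) ℂ) := by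
    ext i j; simp [Matrix.smul_apply]
  rw [hq] at E1 E2
  rw [aux_unitary α hα] at hUni
  rw [aux_unitary α hα, aux_unitary α hα, aux_unitary α hα]
  have hQ0 : (Q : ℂ) ≠ 0 := by exact_mod_cast hQ.ne'
  have hα0 : (α : ℂ) ≠ 0 := by exact_mod_cast hα.ne'
  refine aux_main V₁ V₂ _ _ _ _ (hc1 _) (hc1 _) (hc2 _) (hc2 _)
    (inv_ne_zero (pow_ne_zero 2 hQ0)) (inv_ne_zero (pow_ne_zero 2 hα0)) (by simp) ?_ ?_ ?_ hUni htr
  · rw [← E1]; simp only [conjTranspose_mul, hc1, mul_assoc]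
  · rw [← E2]; simp only [conjTranspose_mul, hc1, mul_assoc]
  · rw [← E3]; simp only [conjTranspose_mul, hc1, mul_assoc]
end

section
/- Let n ≥ 1, Q > 0, and V₁, V₂ ∈ M_n(ℂ). Let W ∈ M_{2n}(ℂ) be the 2×2 block matrix with blocks W₁₁ = V₁·conj(V₁), W₁₂ = V₂·conj(V₁), W₂₁ = V₁·conj(V₂), W₂₂ = V₂·conj(V₂). Then Q·W is unitary if and only if (V₁,V₂) satisfies the rank-two Temperley–Lieb equations with parameter Q, i.e. the three equations: V₁·conj(V₁)·V₁ᵀ·V₁* + V₂·conj(V₁)·V₁ᵀ·V₂* = Q⁻²·I_n, V₁·conj(V₂)·V₂ᵀ·V₁* + V₂·conj(V₂)·V₂ᵀ·V₂* = Q⁻²·I_n, and V₁·conj(V₁)·V₂ᵀ·V₁* + V₂·conj(V₁)·V₂ᵀ·V₂* = 0. -/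
open Matrix

/-- with `W` the 2×2 block matrix with blocks `W₁₁ = V₁ conj(V₁)`,
`W₁₂ = V₂ conj(V₁)`, `W₂₁ = V₁ conj(V₂)`, `W₂₂ = V₂ conj(V₂)`, the matrix `Q·W` is
unitary iff `(V₁, V₂)` satisfies the rank-two Temperley–Lieb equations with parameter `Q`. -/
theorem stmt_8 (n : ℕ) (hn : 1 ≤ n) (Q : ℝ) (hQ : 0 < Q)
    (V₁ V₂ : Matrix (Fin n) (Fin n) ℂ)
    (W : Matrix (Fin n ⊕ Fin n) (Fin n ⊕ Fin n) ℂ)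
    (hW : W = Matrix.fromBlocks
      (V₁ * V₁.map (starRingEnd ℂ)) (V₂ * V₁.map (starRingEnd ℂ))
      (V₁ * V₂.map (starRingEnd ℂ)) (V₂ * V₂.map (starRingEnd ℂ))) :
    (Q : ℂ) • W ∈ Matrix.unitaryGroup (Fin n ⊕ Fin n) ℂ ↔ TLPair Q V₁ V₂ := by
  subst hW
  have hQc : (Q : ℂ) ≠ 0 := by exact_mod_cast hQ.ne'
  have hmap : ∀ V : Matrix (Fin n) (Fin n) ℂ, (V.map (starRingEnd ℂ))ᴴ = Vᵀ := by
    intro V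
    ext i j
    simp
  have hsm : ((Q ^ 2)⁻¹ : ℝ) • (1 : Matrix (Fin n) (Fin n) ℂ)
      = (((Q : ℂ) * Q)⁻¹) • (1 : Matrix (Fin n) (Fin n) ℂ) := by
    ext i j
    simp [Matrix.smul_apply, Complex.real_smul, pow_two]
  have hstar : star (Q : ℂ) = Q := Complex.conj_ofReal Q
  have key : ∀ A B : Matrix (Fin n) (Fin n) ℂ,
      ((Q : ℂ) * Q) • A = B ↔ A = (((Q : ℂ) * Q)⁻¹) • B := by
    intro A B
    exact (eq_inv_smul_iff₀ (mul_ne_zero hQc hQc)).symm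
  rw [Matrix.mem_unitaryGroup_iff, Matrix.star_eq_conjTranspose, Matrix.conjTranspose_smul,
    hstar, Matrix.smul_mul, Matrix.mul_smul, smul_smul, Matrix.fromBlocks_conjTranspose,
    Matrix.fromBlocks_multiply, Matrix.fromBlocks_smul, ← Matrix.fromBlocks_one,
    Matrix.fromBlocks_inj, key, key, key, key]
  simp only [Matrix.conjTranspose_mul, hmap, smul_zero, TLPair, hsm, ← Matrix.mul_assoc]
  constructor
  · rintro ⟨h1, h2, -, h4⟩
    exact ⟨h1, h4, h2⟩
  · rintro ⟨h1, h4, h2⟩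
    refine ⟨h1, h2, ?_, h4⟩
    have h3 := congrArg Matrix.conjTranspose h2
    have hmap2 : ∀ V : Matrix (Fin n) (Fin n) ℂ, Vᵀᴴ = V.map (starRingEnd ℂ) := by
      intro V
      ext i j
      simp
    simpa only [Matrix.conjTranspose_add, Matrix.conjTranspose_mul, hmap, hmap2,
      Matrix.conjTranspose_conjTranspose, Matrix.conjTranspose_zero, ← Matrix.mul_assoc] using h3
end

section
/- Let n be even and let σ₁, σ₂ ∈ S_n. Suppose at least one of the following holds: (a) σ₂⁻¹∘σ₁∘σ₁∘σ₂⁻¹ ≠ σ₁∘σ₂⁻¹∘σ₂⁻¹∘σ₁; or (b) σ₁ and σ₂ have a common fixed point; or (c) σ₁ and σ₂ are both involutions, or σ₁∘σ₂ = σ₂∘σ₁, and σ₂⁻¹∘σ₁ has a fixed point. Then there exist no nonsingular diagonal matrices D₁, D₂ ∈ M_n(ℂ) such that V₁ = D₁·P_{σ₁} and V₂ = D₂·P_{σ₂} satisfy V₁·conj(V₁)·V₂ᵀ·V₁* + V₂·conj(V₁)·V₂ᵀ·V₂* = 0. -/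
open Matrix

/-- The permutation matrix of `σ`, with entries `(P_σ)_{ij} = δ_{i, σ(j)}`. -/
def permMat (R : Type*) [Zero R] [One R] {n : ℕ} (σ : Equiv.Perm (Fin n)) :
    Matrix (Fin n) (Fin n) R :=
  Matrix.of fun i j => if i = σ j then 1 else 0

lemma aux_V {n : ℕ} (s : Equiv.Perm (Fin n)) (d : Fin n → ℂ) (a b : Fin n) :
    (Matrix.diagonal d * permMat ℂ s) a b = if a = s b then d a else 0 := by
  simp [permMat, Matrix.diagonal_mul]

lemma aux1 {n : ℕ} (s : Equiv.Perm (Fin n)) (d : Fin n → ℂ) (j : Fin n) (c : ℂ) :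
    (Matrix.diagonal d * permMat ℂ s) *ᵥ Pi.single j c = Pi.single (s j) (d (s j) * c) := by
  ext a
  rw [Matrix.mulVec_single]
  simp only [Pi.smul_apply, Matrix.col_apply, aux_V, Pi.single_apply]
  by_cases h : a = s j <;> simp [h, mul_comm]

lemma aux1b {n : ℕ} (s : Equiv.Perm (Fin n)) (d : Fin n → ℂ) (j : Fin n) (c : ℂ) :
    Matrix.diagonal d *ᵥ (permMat ℂ s *ᵥ Pi.single j c) = Pi.single (s j) (d (s j) * c) := by
  rw [Matrix.mulVec_mulVec, aux1]

lemma aux5 {n : ℕ} (s : Equiv.Perm (Fin n)) (j : Fin n) : s⁻¹ (s j) = j := by simp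

lemma aux2 {n : ℕ} (s : Equiv.Perm (Fin n)) (d : Fin n → ℂ) (j : Fin n) (c : ℂ) :
    ((Matrix.diagonal d * permMat ℂ s).map (starRingEnd ℂ)) *ᵥ Pi.single j c
      = Pi.single (s j) (starRingEnd ℂ (d (s j)) * c) := by
  ext a
  rw [Matrix.mulVec_single]
  simp only [Pi.smul_apply, Matrix.col_apply, Matrix.map_apply, aux_V, Pi.single_apply]
  by_cases h : a = s j <;> simp [h, mul_comm]

lemma aux3 {n : ℕ} (s : Equiv.Perm (Fin n)) (d : Fin n → ℂ) (j : Fin n) (c : ℂ) :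
    (Matrix.diagonal d * permMat ℂ s)ᵀ *ᵥ Pi.single j c = Pi.single (s⁻¹ j) (d j * c) := by
  ext a
  rw [Matrix.mulVec_single]
  simp only [Pi.smul_apply, Matrix.col_apply, Matrix.transpose_apply, aux_V, Pi.single_apply,
    Equiv.Perm.eq_inv_iff_eq]
  by_cases h : s a = j
  · simp [h, mul_comm]
  · simp [h, Ne.symm h]

lemma aux4 {n : ℕ} (s : Equiv.Perm (Fin n)) (d : Fin n → ℂ) (j : Fin n) (c : ℂ) :
    (Matrix.diagonal d * permMat ℂ s)ᴴ *ᵥ Pi.single j c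
      = Pi.single (s⁻¹ j) (starRingEnd ℂ (d j) * c) := by
  ext a
  rw [Matrix.mulVec_single]
  simp only [Pi.smul_apply, Matrix.col_apply, Matrix.conjTranspose_apply, aux_V, Pi.single_apply,
    Equiv.Perm.eq_inv_iff_eq]
  by_cases h : s a = j
  · simp [h, mul_comm]
  · simp [h, Ne.symm h]

/-- if the pair `(σ₁, σ₂)` is not admissible (condition (a), (b) or (c)),
then equation (E3) has no solution for nonsingular diagonal matrices `D₁, D₂`. -/
theorem stmt_13 (n : ℕ) (hn : Even n) (σ₁ σ₂ : Equiv.Perm (Fin n))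
    (hbad :
      (σ₂⁻¹ * σ₁ * σ₁ * σ₂⁻¹ ≠ σ₁ * σ₂⁻¹ * σ₂⁻¹ * σ₁) ∨
      (∃ k, σ₁ k = k ∧ σ₂ k = k) ∨
      (((σ₁ * σ₁ = 1 ∧ σ₂ * σ₂ = 1) ∨ σ₁ * σ₂ = σ₂ * σ₁) ∧ ∃ k, (σ₂⁻¹ * σ₁) k = k)) :
    ¬ ∃ d₁ d₂ : Fin n → ℂ, (∀ k, d₁ k ≠ 0) ∧ (∀ k, d₂ k ≠ 0) ∧
      (let V₁ := Matrix.diagonal d₁ * permMat ℂ σ₁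
       let V₂ := Matrix.diagonal d₂ * permMat ℂ σ₂
       V₁ * V₁.map (starRingEnd ℂ) * V₂ᵀ * V₁ᴴ +
         V₂ * V₁.map (starRingEnd ℂ) * V₂ᵀ * V₂ᴴ = 0) := by
  rintro ⟨d, e, hd, he, h⟩
  dsimp only at h
  have key : ∀ i, _ := fun i => congrArg (fun M => M *ᵥ Pi.single i (1 : ℂ)) h
  simp only [Matrix.add_mulVec, ← Matrix.mulVec_mulVec, aux1b, aux2, aux3, aux4,
    Matrix.zero_mulVec] at key
  have main : ¬ ∃ q, σ₁ q = σ₂ q ∧ σ₁ (σ₁ q) = σ₂ (σ₁ q) := by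
    rintro ⟨q, h1, h2⟩
    have k := congrFun (key (σ₁ (σ₁ q))) (σ₁ (σ₁ q))
    have e1 : σ₂⁻¹ (σ₁ (σ₁ q)) = σ₁ q := by rw [h2]; simp
    have e2 : σ₂⁻¹ (σ₁ q) = q := by rw [h1]; simp
    simp only [aux5, e1, e2, ← h2, Pi.add_apply, Pi.single_eq_same,
      Pi.zero_apply] at k
    have k2 : (e (σ₁ q) * starRingEnd ℂ (d (σ₁ q))) *
        (d (σ₁ (σ₁ q)) * starRingEnd ℂ (d (σ₁ (σ₁ q)))
          + e (σ₁ (σ₁ q)) * starRingEnd ℂ (e (σ₁ (σ₁ q)))) = 0 := by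
      rw [← k]; ring
    have hne : e (σ₁ q) * starRingEnd ℂ (d (σ₁ q)) ≠ 0 :=
      mul_ne_zero (he _) ((map_ne_zero _).2 (hd _))
    have k3 := (mul_eq_zero.1 k2).resolve_left hne
    rw [Complex.mul_conj, Complex.mul_conj, ← Complex.ofReal_add] at k3
    have k4 := Complex.ofReal_eq_zero.1 k3
    have := Complex.normSq_pos.2 (hd (σ₁ (σ₁ q)))
    have := Complex.normSq_pos.2 (he (σ₁ (σ₁ q)))
    linarith
  rcases hbad with ha | ⟨k, h1, h2⟩ | ⟨h12 | hc, k, hk⟩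
  · apply ha
    ext x
    congr 1
    have kk := congrFun (key (σ₁ x)) (σ₁ (σ₁ (σ₂⁻¹ x)))
    simp only [aux5, Pi.add_apply, Pi.single_eq_same, Pi.zero_apply] at kk
    by_contra hne
    have hne2 : σ₁ (σ₁ (σ₂⁻¹ x)) ≠ σ₂ (σ₁ (σ₂⁻¹ (σ₂⁻¹ (σ₁ x)))) := by
      intro hh
      apply hne
      simp only [Equiv.Perm.mul_apply, hh, aux5]
    rw [Pi.single_eq_of_ne hne2, add_zero] at kk
    simp [hd, he] at kk
  · exact main ⟨k, by rw [h1, h2], by rw [h1, h1, h2]⟩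
  · have hk' : σ₁ k = σ₂ k := by
      rw [Equiv.Perm.mul_apply, Equiv.Perm.inv_eq_iff_eq] at hk; exact hk
    have a1 : σ₁ (σ₁ k) = k := by rw [← Equiv.Perm.mul_apply, h12.1]; rfl
    have a2 : σ₂ (σ₂ k) = k := by rw [← Equiv.Perm.mul_apply, h12.2]; rfl
    exact main ⟨σ₁ k, by rw [a1, hk', a2], by rw [a1, hk']⟩
  · have hk' : σ₁ k = σ₂ k := by
      rw [Equiv.Perm.mul_apply, Equiv.Perm.inv_eq_iff_eq] at hk; exact hk
    refine main ⟨k, hk', ?_⟩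
    rw [← Equiv.Perm.mul_apply σ₂, ← hc, Equiv.Perm.mul_apply, hk']
end

section
/- Let (σ₁, σ₂) be any one of the following ten pairs of permutations of {1,2,3,4} (written in cycle notation): a) σ₁ = id, σ₂ = (12)(34); b) σ₁ = id, σ₂ = (1234); c) σ₁ = (23), σ₂ = (14); d) σ₁ = (23), σ₂ = (1342); e) σ₁ = (23), σ₂ = (12)(34); f) σ₁ = (234), σ₂ = (321); g) σ₁ = (1234), σ₂ = (13)(24); h) σ₁ = (1234), σ₂ = (12)(34); i) σ₁ = (1234), σ₂ = (4321); j) σ₁ = (12)(34), σ₂ = (14)(23). Then there exist vectors u, v ∈ ℝ⁴ such that the matrices V₁ = (1/2)·diag(e^{iπu₁},…,e^{iπu₄})·P_{σ₁} and V₂ = (1/2)·diag(e^{iπv₁},…,e^{iπv₄})·P_{σ₂} satisfy tr(V₁*V₁) = tr(V₂*V₂) = 1, tr(V₁*V₂) = 0, and the rank-two Temperley–Lieb equations with parameter Q = 2√2. -/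
open Matrix

/-- The 4-cycle `(1234)` (on `Fin 4`, the cycle `0 → 1 → 2 → 3 → 0`). -/
def c1234 : Equiv.Perm (Fin 4) := Equiv.swap 0 3 * Equiv.swap 0 2 * Equiv.swap 0 1

/-- The 4-cycle `(1342)` (on `Fin 4`, the cycle `0 → 2 → 3 → 1 → 0`). -/
def c1342 : Equiv.Perm (Fin 4) := Equiv.swap 0 1 * Equiv.swap 0 3 * Equiv.swap 0 2

/-- The 3-cycle `(234)` (on `Fin 4`, the cycle `1 → 2 → 3 → 1`). -/
def c234 : Equiv.Perm (Fin 4) := Equiv.swap 1 3 * Equiv.swap 1 2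

/-- The 3-cycle `(321)` (on `Fin 4`, the cycle `2 → 1 → 0 → 2`). -/
def c321 : Equiv.Perm (Fin 4) := Equiv.swap 2 0 * Equiv.swap 2 1

instance decEqG : DecidableEq GaussianInt := inferInstanceAs (DecidableEq (Zsqrtd (-1)))

/-- Entrywise equality, in a form that is decidable. -/
def EqAll (X : Matrix (Fin 4) (Fin 4) GaussianInt) (g : Fin 4 → Fin 4 → GaussianInt) : Prop :=
  ∀ i j, X i j = g i j

instance (X : Matrix (Fin 4) (Fin 4) GaussianInt) (g : Fin 4 → Fin 4 → GaussianInt) :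
    Decidable (EqAll X g) :=
  @Nat.decidableForallFin 4 _ fun i => @Nat.decidableForallFin 4 _ fun j =>
    decEqG (X i j) (g i j)

/-- The Gaussian integer `i`. -/
def gI : GaussianInt := ⟨0, 1⟩

/-- The monomial matrix with phases `i ^ a k`, over the Gaussian integers. -/
def gMat (a : Fin 4 → ℕ) (σ : Equiv.Perm (Fin 4)) : Matrix (Fin 4) (Fin 4) GaussianInt :=
  Matrix.of fun i j => if i = σ j then gI ^ a i else 0

/-- The finitely many Gaussian integer identities behind the statement. -/
def GOk (M N : Matrix (Fin 4) (Fin 4) GaussianInt) : Prop :=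
  (Mᴴ * M).trace = 4 ∧ (Nᴴ * N).trace = 4 ∧ (Mᴴ * N).trace = 0 ∧
  EqAll (M * M.map star * Mᵀ * Mᴴ + N * M.map star * Mᵀ * Nᴴ) (fun i j => if i = j then 2 else 0) ∧
  EqAll (M * N.map star * Nᵀ * Mᴴ + N * N.map star * Nᵀ * Nᴴ) (fun i j => if i = j then 2 else 0) ∧
  EqAll (M * M.map star * Nᵀ * Mᴴ + N * M.map star * Nᵀ * Nᴴ) (fun _ _ => 0)

lemma toC_gI : GaussianInt.toComplex gI = Complex.I := by
  simp [gI, GaussianInt.toComplex_def]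

lemma diag_eq (a : Fin 4 → ℕ) (σ : Equiv.Perm (Fin 4)) :
    Matrix.diagonal (fun k => Complex.exp (Real.pi * (((a k : ℝ) / 2 : ℝ) : ℂ) * Complex.I)) *
      permMat ℂ σ = (gMat a σ).map GaussianInt.toComplex := by
  ext i j
  have h : Complex.exp (Real.pi * (((a i : ℝ) / 2 : ℝ) : ℂ) * Complex.I) = Complex.I ^ a i := by
    have e := Complex.exp_pi_div_two_mul_I
    conv_rhs => rw [← e, ← Complex.exp_nat_mul]
    congr 1
    push_cast
    ring
  rw [Matrix.diagonal_mul, h]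
  by_cases hij : i = σ j <;> simp [permMat, gMat, hij, toC_gI]

lemma map_star_eq (M : Matrix (Fin 4) (Fin 4) GaussianInt) :
    (M.map GaussianInt.toComplex).map (starRingEnd ℂ) =
      (M.map star).map GaussianInt.toComplex := by
  ext i j
  simp [GaussianInt.toComplex_star]

lemma map_conjT_eq (M : Matrix (Fin 4) (Fin 4) GaussianInt) :
    (M.map GaussianInt.toComplex)ᴴ = Mᴴ.map GaussianInt.toComplex := by
  ext i j
  simp [GaussianInt.toComplex_star]

lemma map_transp_eq (M : Matrix (Fin 4) (Fin 4) GaussianInt) :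
    (M.map GaussianInt.toComplex)ᵀ = Mᵀ.map GaussianInt.toComplex := rfl

lemma trace_map_eq (M : Matrix (Fin 4) (Fin 4) GaussianInt) :
    (M.map GaussianInt.toComplex).trace = GaussianInt.toComplex M.trace := by
  simp [Matrix.trace]

lemma half_map_conj (A : Matrix (Fin 4) (Fin 4) ℂ) :
    ((1/2 : ℂ) • A).map (starRingEnd ℂ) = (1/2 : ℂ) • A.map (starRingEnd ℂ) := by
  ext i j
  simp [Complex.conj_ofNat]

lemma half_conjT (A : Matrix (Fin 4) (Fin 4) ℂ) :
    ((1/2 : ℂ) • A)ᴴ = (1/2 : ℂ) • Aᴴ := by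
  ext i j
  simp

lemma quad_eq (A B C D : Matrix (Fin 4) (Fin 4) GaussianInt) :
    ((1/2 : ℂ) • A.map GaussianInt.toComplex) * ((1/2 : ℂ) • B.map GaussianInt.toComplex) *
      ((1/2 : ℂ) • C.map GaussianInt.toComplex) * ((1/2 : ℂ) • D.map GaussianInt.toComplex) =
    (1/16 : ℂ) • (A * B * C * D).map GaussianInt.toComplex := by
  simp only [Matrix.map_mul, Matrix.smul_mul, Matrix.mul_smul, smul_smul]
  norm_num

lemma scal_eq {X Y : Matrix (Fin 4) (Fin 4) GaussianInt}
    (h : ∀ i j, (X + Y) i j = if i = j then 2 else 0) :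
    (1/16 : ℂ) • X.map GaussianInt.toComplex + (1/16 : ℂ) • Y.map GaussianInt.toComplex =
      ((2 * Real.sqrt 2) ^ 2)⁻¹ • (1 : Matrix (Fin 4) (Fin 4) ℂ) := by
  have hQ : ((2 * Real.sqrt 2) ^ 2)⁻¹ = (1/8 : ℝ) := by
    rw [mul_pow, Real.sq_sqrt (by norm_num)]; norm_num
  rw [hQ]
  ext i j
  have := congrArg GaussianInt.toComplex (h i j)
  rw [Matrix.add_apply, map_add] at this
  simp only [Matrix.add_apply, Matrix.smul_apply, Matrix.map_apply, smul_eq_mul, ← mul_add, this]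
  by_cases hij : i = j
  · subst hij
    have h2 : GaussianInt.toComplex 2 = 2 := map_ofNat _ 2
    simp [h2]
    norm_num
  · simp [hij]

lemma key (σ₁ σ₂ : Equiv.Perm (Fin 4)) (a b : Fin 4 → ℕ) (h : GOk (gMat a σ₁) (gMat b σ₂)) :
    ∃ u v : Fin 4 → ℝ,
      let V₁ := (1/2 : ℂ) •
        (Matrix.diagonal (fun k => Complex.exp (Real.pi * (u k) * Complex.I)) *
          permMat ℂ σ₁)
      let V₂ := (1/2 : ℂ) •
        (Matrix.diagonal (fun k => Complex.exp (Real.pi * (v k) * Complex.I)) *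
          permMat ℂ σ₂)
      (V₁ᴴ * V₁).trace = 1 ∧ (V₂ᴴ * V₂).trace = 1 ∧ (V₁ᴴ * V₂).trace = 0 ∧
      TLPair (2 * Real.sqrt 2) V₁ V₂ := by
  refine ⟨fun k => (a k : ℝ) / 2, fun k => (b k : ℝ) / 2, ?_⟩
  simp only [diag_eq]
  generalize gMat a σ₁ = M at *
  generalize gMat b σ₂ = N at *
  obtain ⟨h1, h2, h3, h4, h5, h6⟩ := h
  have htr : ∀ A B : Matrix (Fin 4) (Fin 4) GaussianInt,
      (((1/2 : ℂ) • A.map GaussianInt.toComplex)ᴴ *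
        ((1/2 : ℂ) • B.map GaussianInt.toComplex)).trace =
      (1/4 : ℂ) * GaussianInt.toComplex (Aᴴ * B).trace := by
    intro A B
    rw [half_conjT, map_conjT_eq, Matrix.smul_mul, Matrix.mul_smul, smul_smul,
      ← Matrix.map_mul, Matrix.trace_smul, trace_map_eq, smul_eq_mul]
    norm_num
  have h4' : GaussianInt.toComplex 4 = 4 := map_ofNat _ 4
  refine ⟨?_, ?_, ?_, ?_, ?_, ?_⟩
  · rw [htr, h1, h4']; norm_num
  · rw [htr, h2, h4']; norm_num
  · rw [htr, h3]; simp
  · simp only [half_conjT, half_map_conj, map_conjT_eq, map_star_eq, Matrix.transpose_smul,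
      map_transp_eq, quad_eq]
    exact scal_eq h4
  · simp only [half_conjT, half_map_conj, map_conjT_eq, map_star_eq, Matrix.transpose_smul,
      map_transp_eq, quad_eq]
    exact scal_eq h5
  · simp only [half_conjT, half_map_conj, map_conjT_eq, map_star_eq, Matrix.transpose_smul,
      map_transp_eq, quad_eq]
    ext i j
    have := congrArg GaussianInt.toComplex (h6 i j)
    rw [Matrix.add_apply, map_add] at this
    simp only [Matrix.add_apply, Matrix.smul_apply, Matrix.map_apply, smul_eq_mul, ← mul_add, this]
    simp

/-- for each of the ten admissible pairs of permutations of `S₄`, there are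
phase vectors `u, v ∈ ℝ⁴` such that the associated generalized permutation matrices give a
rank-two Temperley–Lieb solution with `Q = 2√2`. -/
theorem stmt_14 (σ₁ σ₂ : Equiv.Perm (Fin 4))
    (hcase :
      (σ₁ = 1 ∧ σ₂ = Equiv.swap 0 1 * Equiv.swap 2 3) ∨
      (σ₁ = 1 ∧ σ₂ = c1234) ∨
      (σ₁ = Equiv.swap 1 2 ∧ σ₂ = Equiv.swap 0 3) ∨
      (σ₁ = Equiv.swap 1 2 ∧ σ₂ = c1342) ∨
      (σ₁ = Equiv.swap 1 2 ∧ σ₂ = Equiv.swap 0 1 * Equiv.swap 2 3) ∨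
      (σ₁ = c234 ∧ σ₂ = c321) ∨
      (σ₁ = c1234 ∧ σ₂ = Equiv.swap 0 2 * Equiv.swap 1 3) ∨
      (σ₁ = c1234 ∧ σ₂ = Equiv.swap 0 1 * Equiv.swap 2 3) ∨
      (σ₁ = c1234 ∧ σ₂ = c1234⁻¹) ∨
      (σ₁ = Equiv.swap 0 1 * Equiv.swap 2 3 ∧ σ₂ = Equiv.swap 0 3 * Equiv.swap 1 2)) :
    ∃ u v : Fin 4 → ℝ,
      let V₁ := (1/2 : ℂ) •
        (Matrix.diagonal (fun k => Complex.exp (Real.pi * (u k) * Complex.I)) *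
          permMat ℂ σ₁)
      let V₂ := (1/2 : ℂ) •
        (Matrix.diagonal (fun k => Complex.exp (Real.pi * (v k) * Complex.I)) *
          permMat ℂ σ₂)
      (V₁ᴴ * V₁).trace = 1 ∧ (V₂ᴴ * V₂).trace = 1 ∧ (V₁ᴴ * V₂).trace = 0 ∧
      TLPair (2 * Real.sqrt 2) V₁ V₂ := by
  rcases hcase with ⟨rfl, rfl⟩ | ⟨rfl, rfl⟩ | ⟨rfl, rfl⟩ | ⟨rfl, rfl⟩ | ⟨rfl, rfl⟩ | ⟨rfl, rfl⟩ | ⟨rfl, rfl⟩ | ⟨rfl, rfl⟩ | ⟨rfl, rfl⟩ | ⟨rfl, rfl⟩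
  · exact key _ _ ![0, 0, 0, 0] ![0, 1, 0, 1] ⟨by decide +kernel, by decide +kernel, by decide +kernel,
      by decide +kernel, by decide +kernel, by decide +kernel⟩
  · exact key _ _ ![0, 0, 2, 2] ![0, 0, 0, 0] ⟨by decide +kernel, by decide +kernel, by decide +kernel,
      by decide +kernel, by decide +kernel, by decide +kernel⟩
  · exact key _ _ ![0, 0, 1, 0] ![0, 0, 0, 1] ⟨by decide +kernel, by decide +kernel, by decide +kernel,
      by decide +kernel, by decide +kernel, by decide +kernel⟩
  · exact key _ _ ![0, 0, 0, 2] ![0, 0, 0, 2] ⟨by decide +kernel, by decide +kernel, by decide +kernel,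
      by decide +kernel, by decide +kernel, by decide +kernel⟩
  · exact key _ _ ![0, 0, 2, 0] ![0, 0, 0, 0] ⟨by decide +kernel, by decide +kernel, by decide +kernel,
      by decide +kernel, by decide +kernel, by decide +kernel⟩
  · exact key _ _ ![0, 0, 0, 0] ![0, 0, 2, 2] ⟨by decide +kernel, by decide +kernel, by decide +kernel,
      by decide +kernel, by decide +kernel, by decide +kernel⟩
  · exact key _ _ ![0, 0, 0, 0] ![0, 0, 2, 2] ⟨by decide +kernel, by decide +kernel, by decide +kernel,
      by decide +kernel, by decide +kernel, by decide +kernel⟩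
  · exact key _ _ ![0, 0, 0, 0] ![0, 0, 0, 2] ⟨by decide +kernel, by decide +kernel, by decide +kernel,
      by decide +kernel, by decide +kernel, by decide +kernel⟩
  · exact key _ _ ![0, 0, 0, 0] ![0, 0, 0, 2] ⟨by decide +kernel, by decide +kernel, by decide +kernel,
      by decide +kernel, by decide +kernel, by decide +kernel⟩
  · exact key _ _ ![0, 0, 0, 0] ![0, 0, 0, 2] ⟨by decide +kernel, by decide +kernel, by decide +kernel,
      by decide +kernel, by decide +kernel, by decide +kernel⟩
end

section
/- Let n be even and let σ₁, σ₂ ∈ S_n satisfy σ₁∘σ₂∘σ₂ = σ₂∘σ₂∘σ₁ and σ₂∘σ₁∘σ₁ = σ₁∘σ₁∘σ₂, and suppose σ₂⁻¹∘σ₁ has no fixed points. Define A = (I_n + P_{σ₂})(P_{σ₂} − P_{σ₁}) and B = (I_n + P_{σ₁})(P_{σ₁} − P_{σ₂}). Let x ∈ ℝⁿ satisfy P_{σ₁}·x = P_{σ₂}·x = −x, and suppose there exist u, v ∈ ℝⁿ such that every component of the vector w = A·u + B·v is an odd integer. Let μ > 0 with μ² = ∑_{k=1}^n e^{2x_k},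 and let D₁, D₂ ∈ M_n(ℂ) be the diagonal matrices with (D₁)_{kk} = μ⁻¹·e^{x_k + iπu_k} and (D₂)_{kk} = μ⁻¹·e^{x_k + iπv_k}. Then V₁ = D₁·P_{σ₁} and V₂ = D₂·P_{σ₂} satisfy tr(V₁*V₁) = tr(V₂*V₂) = 1, tr(V₁*V₂) = 0, and the rank-two Temperley–Lieb equations with parameter Q = (1/√2)·∑_{k=1}^n e^{2x_k}. -/
open Matrix

def monoMat {n : ℕ} (d : Fin n → ℂ) (σ : Equiv.Perm (Fin n)) : Matrix (Fin n) (Fin n) ℂ :=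
  Matrix.of fun i j => if i = σ j then d i else 0

theorem monoMat_mul {n : ℕ} (d e : Fin n → ℂ) (σ τ : Equiv.Perm (Fin n)) :
    monoMat d σ * monoMat e τ = monoMat (fun i => d i * e (σ⁻¹ i)) (σ * τ) := by
  ext i j
  simp only [monoMat, Matrix.mul_apply, Matrix.of_apply]
  rw [Finset.sum_eq_single (τ j)]
  · by_cases h : i = σ (τ j)
    · simp [h]
    · simp [h]
  · intro b _ hb
    simp [hb]
  · simp

theorem monoMat_transpose {n : ℕ} (d : Fin n → ℂ) (σ : Equiv.Perm (Fin n)) :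
    (monoMat d σ)ᵀ = monoMat (fun i => d (σ i)) σ⁻¹ := by
  ext i j
  simp only [monoMat, Matrix.transpose_apply, Matrix.of_apply, Equiv.Perm.eq_inv_iff_eq]
  by_cases h : j = σ i
  · simp [h]
  · simp [h, Ne.symm h]

theorem monoMat_map {n : ℕ} (d : Fin n → ℂ) (σ : Equiv.Perm (Fin n)) :
    (monoMat d σ).map (starRingEnd ℂ) = monoMat (fun i => starRingEnd ℂ (d i)) σ := by
  ext i j
  simp only [monoMat, Matrix.map_apply, Matrix.of_apply]
  split_ifs <;> simp

theorem monoMat_conjTranspose {n : ℕ} (d : Fin n → ℂ) (σ : Equiv.Perm (Fin n)) :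
    (monoMat d σ)ᴴ = monoMat (fun i => starRingEnd ℂ (d (σ i))) σ⁻¹ := by
  have h : (monoMat d σ)ᴴ = ((monoMat d σ).map (starRingEnd ℂ))ᵀ := rfl
  rw [h, monoMat_map, monoMat_transpose]

theorem diagonal_mul_permMat {n : ℕ} (d : Fin n → ℂ) (σ : Equiv.Perm (Fin n)) :
    Matrix.diagonal d * permMat ℂ σ = monoMat d σ := by
  ext i j
  simp [monoMat, permMat, Matrix.diagonal_mul]

theorem permMat_mulVec {n : ℕ} (σ : Equiv.Perm (Fin n)) (y : Fin n → ℝ) (k : Fin n) :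
    (permMat ℝ σ).mulVec y k = y (σ⁻¹ k) := by
  simp only [permMat, Matrix.mulVec, dotProduct, Matrix.of_apply]
  rw [Finset.sum_eq_single (σ⁻¹ k)]
  · simp
  · intro b _ hb
    have : k ≠ σ b := by
      rintro rfl
      simp at hb
    simp [this]
  · simp

theorem conj_entry (μ a b : ℝ) :
    starRingEnd ℂ ((μ : ℂ)⁻¹ * Complex.exp ((a : ℂ) + Real.pi * b * Complex.I)) =
      (μ : ℂ)⁻¹ * Complex.exp ((a : ℂ) - Real.pi * b * Complex.I) := by
  rw [map_mul, map_inv₀, Complex.conj_ofReal, ← Complex.exp_conj]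
  congr 2
  simp [sub_eq_add_neg]

theorem exp_odd (z : ℂ) (m : ℤ) (hm : Odd m) :
    Complex.exp (z + Real.pi * (m : ℂ) * Complex.I) = - Complex.exp z := by
  obtain ⟨k, rfl⟩ := hm
  have h : (z + Real.pi * ((2 * k + 1 : ℤ) : ℂ) * Complex.I) =
      (z + Real.pi * Complex.I) + k * (2 * Real.pi * Complex.I) := by
    push_cast; ring
  rw [h, Complex.exp_add, Complex.exp_int_mul_two_pi_mul_I, mul_one, Complex.exp_add,
    Complex.exp_pi_mul_I]
  ring

/-- the varying-`Q` construction (Theorem `DDSS` of the paper). -/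
theorem stmt_16 (n : ℕ) (hn : Even n) (σ₁ σ₂ : Equiv.Perm (Fin n))
    (hc₁ : σ₁ * σ₂ * σ₂ = σ₂ * σ₂ * σ₁)
    (hc₂ : σ₂ * σ₁ * σ₁ = σ₁ * σ₁ * σ₂)
    (hnofix : ∀ k, (σ₂⁻¹ * σ₁) k ≠ k)
    (A B : Matrix (Fin n) (Fin n) ℝ)
    (hA : A = (1 + permMat ℝ σ₂) * (permMat ℝ σ₂ - permMat ℝ σ₁))
    (hB : B = (1 + permMat ℝ σ₁) * (permMat ℝ σ₁ - permMat ℝ σ₂))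
    (x : Fin n → ℝ)
    (hx₁ : (permMat ℝ σ₁).mulVec x = -x)
    (hx₂ : (permMat ℝ σ₂).mulVec x = -x)
    (u v : Fin n → ℝ)
    (hw : ∀ k, ∃ m : ℤ, Odd m ∧ (A.mulVec u + B.mulVec v) k = (m : ℝ))
    (μ : ℝ) (hμ : 0 < μ) (hμ2 : μ ^ 2 = ∑ k, Real.exp (2 * x k))
    (D₁ D₂ : Matrix (Fin n) (Fin n) ℂ)
    (hD₁ : D₁ = Matrix.diagonal fun k =>
      (μ : ℂ)⁻¹ * Complex.exp ((x k : ℂ) + Real.pi * (u k) * Complex.I))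
    (hD₂ : D₂ = Matrix.diagonal fun k =>
      (μ : ℂ)⁻¹ * Complex.exp ((x k : ℂ) + Real.pi * (v k) * Complex.I)) :
    let V₁ := D₁ * permMat ℂ σ₁
    let V₂ := D₂ * permMat ℂ σ₂
    (V₁ᴴ * V₁).trace = 1 ∧ (V₂ᴴ * V₂).trace = 1 ∧ (V₁ᴴ * V₂).trace = 0 ∧
    TLPair ((1 / Real.sqrt 2) * ∑ k, Real.exp (2 * x k)) V₁ V₂ := by
  have hx1 : ∀ k, x (σ₁⁻¹ k) = - x k := fun k => by
    rw [← permMat_mulVec σ₁ x, hx₁]; rfl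
  have hx2 : ∀ k, x (σ₂⁻¹ k) = - x k := fun k => by
    rw [← permMat_mulVec σ₂ x, hx₂]; rfl
  have hy1 : ∀ k, x (σ₁ k) = - x k := fun k => by
    have := hx1 (σ₁ k)
    simp at this; linarith
  have hμc : (μ : ℂ) ≠ 0 := by exact_mod_cast hμ.ne'
  have hw' : ∀ k, ∃ m : ℤ, Odd m ∧
      u (σ₂⁻¹ k) - u (σ₁⁻¹ k) + (u (σ₂⁻¹ (σ₂⁻¹ k)) - u (σ₁⁻¹ (σ₂⁻¹ k)))
      + (v (σ₁⁻¹ k) - v (σ₂⁻¹ k) + (v (σ₁⁻¹ (σ₁⁻¹ k)) - v (σ₂⁻¹ (σ₁⁻¹ k)))) = (m : ℝ) := by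
    intro k
    obtain ⟨m, hm, h⟩ := hw k
    refine ⟨m, hm, ?_⟩
    rw [← h, hA, hB]
    simp only [Pi.add_apply, ← Matrix.mulVec_mulVec, Matrix.add_mulVec, Matrix.one_mulVec,
      Matrix.sub_mulVec, Pi.sub_apply, permMat_mulVec]
  intro V₁ V₂
  have hV₁ : V₁ = monoMat (fun k =>
      (μ : ℂ)⁻¹ * Complex.exp ((x k : ℂ) + Real.pi * (u k) * Complex.I)) σ₁ := by
    rw [← diagonal_mul_permMat, ← hD₁]
  have hV₂ : V₂ = monoMat (fun k =>
      (μ : ℂ)⁻¹ * Complex.exp ((x k : ℂ) + Real.pi * (v k) * Complex.I)) σ₂ := by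
    rw [← diagonal_mul_permMat, ← hD₂]
  have htr : ∀ (y : Fin n → ℝ) (σ : Equiv.Perm (Fin n)),
      ((monoMat (fun k => (μ : ℂ)⁻¹ * Complex.exp ((x k : ℂ) + Real.pi * (y k) * Complex.I)) σ)ᴴ *
        monoMat (fun k => (μ : ℂ)⁻¹ * Complex.exp ((x k : ℂ) + Real.pi * (y k) * Complex.I)) σ).trace
        = 1 := by
    intro y σ
    rw [monoMat_conjTranspose, monoMat_mul]
    simp only [Matrix.trace, Matrix.diag, monoMat, Matrix.of_apply, inv_mul_cancel, conj_entry,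
      inv_inv, Equiv.Perm.coe_one, id_eq, if_true]
    rw [Equiv.sum_comp σ (fun k => (μ : ℂ)⁻¹ * Complex.exp ((x k : ℂ) - Real.pi * (y k) * Complex.I)
      * ((μ : ℂ)⁻¹ * Complex.exp ((x k : ℂ) + Real.pi * (y k) * Complex.I)))]
    have : ∀ k, (μ : ℂ)⁻¹ * Complex.exp ((x k : ℂ) - Real.pi * (y k) * Complex.I)
      * ((μ : ℂ)⁻¹ * Complex.exp ((x k : ℂ) + Real.pi * (y k) * Complex.I)) =
        ((μ : ℂ) ^ 2)⁻¹ * (Real.exp (2 * x k) : ℝ) := by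
      intro k
      rw [mul_mul_mul_comm, ← Complex.exp_add, Complex.ofReal_exp]
      congr 1
      · rw [sq, mul_inv]
      · congr 1; push_cast; ring
    simp only [this]
    rw [← Finset.mul_sum, ← Complex.ofReal_sum, ← hμ2]
    push_cast
    exact inv_mul_cancel₀ (pow_ne_zero 2 hμc)
  -- the common form of the summands in (E1), (E2)
  have hE : ∀ (y z : Fin n → ℝ) (σ τ : Equiv.Perm (Fin n)), (∀ k, x (σ⁻¹ k) = - x k) →
      monoMat (fun k => (μ : ℂ)⁻¹ * Complex.exp ((x k : ℂ) + Real.pi * (y k) * Complex.I)) σ *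
      (monoMat (fun k => (μ : ℂ)⁻¹ * Complex.exp ((x k : ℂ) + Real.pi * (z k) * Complex.I)) τ).map
        (starRingEnd ℂ) *
      (monoMat (fun k => (μ : ℂ)⁻¹ * Complex.exp ((x k : ℂ) + Real.pi * (z k) * Complex.I)) τ)ᵀ *
      (monoMat (fun k => (μ : ℂ)⁻¹ * Complex.exp ((x k : ℂ) + Real.pi * (y k) * Complex.I)) σ)ᴴ
        = ((μ : ℂ) ^ 4)⁻¹ • (1 : Matrix (Fin n) (Fin n) ℂ) := by
    intro y z σ τ hσ
    rw [monoMat_conjTranspose, monoMat_transpose, monoMat_map, monoMat_mul, monoMat_mul,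
      monoMat_mul]
    ext i j
    have a1 : τ ((σ * τ)⁻¹ i) = σ⁻¹ i := by simp
    have a2 : σ ((σ * τ * τ⁻¹)⁻¹ i) = i := by simp
    have a3 : σ * τ * τ⁻¹ * σ⁻¹ = 1 := by group
    rw [a3]
    simp only [monoMat, Matrix.of_apply, conj_entry, Matrix.smul_apply, Matrix.one_apply,
      a1, a2, Equiv.Perm.coe_one, id_eq, smul_eq_mul, mul_ite, mul_one, mul_zero]
    split_ifs with h
    · rw [hσ]
      have : ∀ a b c d e : ℂ, e * Complex.exp a * (e * Complex.exp b) * (e * Complex.exp c) *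
          (e * Complex.exp d) = e ^ 4 * Complex.exp (a + b + c + d) := by
        intro a b c d e
        rw [Complex.exp_add, Complex.exp_add, Complex.exp_add]; ring
      rw [this, inv_pow]
      convert mul_one _
      rw [← Complex.exp_zero]
      congr 1; push_cast; ring
    · rfl
  have hQ : (((1 / Real.sqrt 2) * ∑ k, Real.exp (2 * x k)) ^ 2)⁻¹ = 2 * (μ ^ 4)⁻¹ := by
    rw [← hμ2, mul_pow, div_pow, Real.sq_sqrt (by norm_num)]
    field_simp
  have hfin : ((μ : ℂ) ^ 4)⁻¹ • (1 : Matrix (Fin n) (Fin n) ℂ) + ((μ : ℂ) ^ 4)⁻¹ • 1 =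
      (2 * (μ ^ 4)⁻¹ : ℝ) • (1 : Matrix (Fin n) (Fin n) ℂ) := by
    ext i j
    simp only [Matrix.add_apply, Matrix.smul_apply, smul_eq_mul, Complex.real_smul]
    push_cast; ring
  rw [hV₁, hV₂]
  refine ⟨htr _ _, htr _ _, ?_, ?_, ?_, ?_⟩
  · rw [monoMat_conjTranspose, monoMat_mul]
    simp only [Matrix.trace, Matrix.diag, monoMat, Matrix.of_apply]
    refine Finset.sum_eq_zero fun k _ => if_neg fun h => hnofix k ?_
    rw [Equiv.Perm.mul_apply, Equiv.Perm.eq_inv_iff_eq] at h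
    rw [Equiv.Perm.mul_apply, Equiv.Perm.inv_eq_iff_eq, h]
  · rw [hE u u σ₁ σ₁ hx1, hE v u σ₂ σ₁ hx2, hQ, hfin]
  · rw [hE u v σ₁ σ₂ hx1, hE v v σ₂ σ₂ hx2, hQ, hfin]
  · simp only [monoMat_conjTranspose, monoMat_transpose, monoMat_map, monoMat_mul]
    have hp1 : σ₁ * σ₁ * σ₂⁻¹ * σ₁⁻¹ = σ₂⁻¹ * σ₁ := by
      have : σ₁ * σ₁ * σ₂⁻¹ = σ₂⁻¹ * (σ₁ * σ₁) := by
        rw [mul_inv_eq_iff_eq_mul, mul_assoc, eq_inv_mul_iff_mul_eq, ← hc₂]; group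
      rw [this]; group
    have hp2 : σ₂ * σ₁ * σ₂⁻¹ * σ₂⁻¹ = σ₂⁻¹ * σ₁ := by
      rw [mul_inv_eq_iff_eq_mul, mul_inv_eq_iff_eq_mul, eq_comm]
      rw [mul_assoc, mul_assoc, inv_mul_eq_iff_eq_mul, ← mul_assoc, ← mul_assoc, hc₁]
    rw [hp1, hp2]
    ext i j
    simp only [monoMat, Matrix.of_apply, Matrix.add_apply, Matrix.zero_apply]
    by_cases h : i = (σ₂⁻¹ * σ₁) j
    swap
    · rw [if_neg h, if_neg h, add_zero]
    rw [if_pos h, if_pos h]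
    have hj : σ₁⁻¹ (σ₂ i) = j := by simp [h]
    have e1 : σ₂ ((σ₁ * σ₁)⁻¹ i) = σ₁⁻¹ j := by
      rw [← hj]
      change (σ₂ * (σ₁ * σ₁)⁻¹) i = (σ₁⁻¹ * (σ₁⁻¹ * σ₂)) i
      congr 1
      rw [mul_inv_eq_iff_eq_mul, mul_assoc, mul_assoc, eq_inv_mul_iff_mul_eq,
        eq_inv_mul_iff_mul_eq, ← mul_assoc, ← mul_assoc, ← hc₂]
    have e2 : σ₁ ((σ₁ * σ₁ * σ₂⁻¹)⁻¹ i) = j := by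
      have : (σ₁ * σ₁ * σ₂⁻¹)⁻¹ i = σ₂ ((σ₁ * σ₁)⁻¹ i) := by simp
      rw [this, e1]; simp
    have e4 : σ₂ ((σ₂ * σ₁ * σ₂⁻¹)⁻¹ i) = j := by
      have h3 : σ₂ * (σ₂ * σ₁ * σ₂⁻¹)⁻¹ = (σ₂⁻¹ * σ₁)⁻¹ := by
        rw [← hp2]; simp only [_root_.mul_inv_rev, inv_inv, mul_assoc]
      have := congrArg (fun p : Equiv.Perm (Fin n) => p i) h3
      simp only [Equiv.Perm.mul_apply] at this
      rw [this, h]; simp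
    have e3 : σ₂ ((σ₂ * σ₁)⁻¹ i) = σ₂⁻¹ j := by
      rw [Equiv.Perm.eq_inv_iff_eq, ← e4]; simp
    rw [e1, e2, e3, e4]
    simp only [conj_entry]
    obtain ⟨m, hm, hwm⟩ := hw' (σ₂ i)
    have hinv : σ₂⁻¹ (σ₂ i) = i := by simp
    rw [hj, hinv] at hwm
    have hxj : x j = x i := by
      rw [← hj, hx1]
      have := hx2 (σ₂ i)
      rw [hinv] at this
      linarith
    have hprod : ∀ a b c d e : ℂ, e * Complex.exp a * (e * Complex.exp b) * (e * Complex.exp c) *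
          (e * Complex.exp d) = e ^ 4 * Complex.exp (a + b + c + d) := by
      intro a b c d e
      rw [Complex.exp_add, Complex.exp_add, Complex.exp_add]; ring
    rw [hprod, hprod, ← mul_add, hx1, hx1, hx2, hx2, hxj]
    have hwc := congrArg (fun r : ℝ => (r : ℂ)) hwm
    push_cast at hwc
    have := exp_odd (((x i : ℂ) + Real.pi * v i * Complex.I) +
      ((-x i : ℝ) - Real.pi * u (σ₂⁻¹ i) * Complex.I) +
      ((-x i : ℝ) + Real.pi * v (σ₂⁻¹ j) * Complex.I) +
      (x i - Real.pi * v j * Complex.I)) m hm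
    rw [← hwc] at this
    rw [← neg_eq_iff_eq_neg] at this
    rw [← this]
    convert mul_zero _
    rw [add_neg_eq_zero]
    congr 1
    push_cast
    ring
end
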